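/- arXiv:2310.15064 — 3 statements merged into one kernel-verified Lean document; each statement's English description precedes it below -/
import Mathlib

section
/- For every integer k ≥ 1 with k ≠ 3 and k ≠ 6, there exists a complementary binary morphism of length k that is cubefree. -/
/-- The Thue–Morse word: `tm n` is the parity of the number of 1s in the
binary representation of `n` (`true` = letter 1, `false` = letter 0). -/
def tm (n : ℕ) : Bool := ((Nat.digits 2 n).count 1) % 2 == 1

/-- The factor `t[ℓ..ℓ+k-1]` of the Thue–Morse word. -/
def tmFactor (ℓ k : ℕ) : List Bool := (List.range k).map (fun i => tm (ℓ + i))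

/-- Complement of a binary word (exchange 0 and 1 in every position). -/
def wcompl (w : List Bool) : List Bool := w.map (fun b => !b)

/-- Apply the binary morphism `0 ↦ h0, 1 ↦ h1` to the word `w`. -/
def applyMorph (h0 h1 : List Bool) (w : List Bool) : List Bool :=
  (w.map (fun b => bif b then h1 else h0)).flatten

/-- The Thue–Morse morphism μ : 0 ↦ 01, 1 ↦ 10. -/
def mu : List Bool → List Bool := applyMorph [false, true] [true, false]

/-- `p` is a period of the finite word `w`: `1 ≤ p ≤ |w|` and `w[i] = w[i+p]`
for all `i` with `i + p < |w|`. -/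
def HasPeriodW (w : List Bool) (p : ℕ) : Prop :=
  1 ≤ p ∧ p ≤ w.length ∧ ∀ i, i + p < w.length → w.getD i false = w.getD (i + p) false

/-- The smallest period of `w`. -/
noncomputable def per (w : List Bool) : ℕ := sInf {p | HasPeriodW w p}

/-- The exponent of `w`: `|w| / per(w)`. -/
noncomputable def wexp (w : List Bool) : ℝ := (w.length : ℝ) / (per w : ℝ)

/-- The critical exponent of `w`: supremum of exponents of nonempty factors of `w`. -/
noncomputable def ce (w : List Bool) : ℝ :=
  sSup {r : ℝ | ∃ x : List Bool, x ≠ [] ∧ x <:+: w ∧ r = wexp x}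

/-- A `k`-prefix: the length-`k` prefix of the Thue–Morse word, or its complement. -/
def kPrefix (k : ℕ) (s : List Bool) : Prop :=
  s = tmFactor 0 k ∨ s = wcompl (tmFactor 0 k)

/-- `v` is a finite factor of the Thue–Morse word. -/
def IsTMFactor (v : List Bool) : Prop := ∃ ℓ, v = tmFactor ℓ v.length

/-- The complementary morphism `0 ↦ h0, 1 ↦ complement of h0` is cubefree:
it maps every word of critical exponent `< 3` to a word of critical exponent `< 3`. -/
def CubefreeC (h0 : List Bool) : Prop :=
  ∀ w : List Bool, ce w < 3 → ce (applyMorph h0 (wcompl h0) w) < 3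

/-- The word `x` occurs at position `i` of the word `w`. -/
def OccursAt (x w : List Bool) (i : ℕ) : Prop :=
  i + x.length ≤ w.length ∧ (w.drop i).take x.length = x

/-- The first `N` letters of `w` contain no cube. -/
def CubeFree (w : ℕ → Bool) (N : ℕ) : Prop :=
  ∀ i p, 1 ≤ p → i + 3 * p ≤ N → ¬ ∀ j < 2 * p, w (i + j) = w (i + j + p)

/-- The first `L` letters of `u` contain no cube whose period is at most `P`. -/
def ShortCubeFree (u : ℕ → Bool) (P L : ℕ) : Prop :=
  ∀ i p, 1 ≤ p → p ≤ P → i + 3 * p ≤ L → ¬ ∀ j < 2 * p, u (i + j) = u (i + j + p)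

/-- The image of `w` under the complementary morphism of length `k` that maps `0` to
`s 0, …, s (k - 1)`. -/
def image (s : ℕ → Bool) (k : ℕ) (w : ℕ → Bool) (i : ℕ) : Bool :=
  xor (s (i % k)) (w (i / k))

/-- The complementary morphism of length `k` given by `s` is cubefree. -/
def CubeFreeMorphism (s : ℕ → Bool) (k : ℕ) : Prop :=
  ∀ w N, CubeFree w N → CubeFree (image s k w) (k * N)

/-- The binary word `0 c d`. -/
def tripleWord (c d : Bool) (n : ℕ) : Bool :=
  if n = 0 then false else if n = 1 then c else d

/-! ### Critical exponents and cubes -/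

theorem hasPeriodW_per {x : List Bool} (hx : x ≠ []) : HasPeriodW x (per x) := by
  have h : {p | HasPeriodW x p}.Nonempty :=
    ⟨x.length, List.length_pos_iff.2 hx, le_rfl, fun i hi => by omega⟩
  exact Nat.sInf_mem h

theorem wexp_le_length {x : List Bool} (hx : x ≠ []) : wexp x ≤ x.length := by
  have h := (hasPeriodW_per hx).1
  have h' : (1 : ℝ) ≤ per x := by exact_mod_cast h
  exact div_le_self (by positivity) h'

theorem bddAbove_wexp (w : List Bool) :
    BddAbove {r : ℝ | ∃ x : List Bool, x ≠ [] ∧ x <:+: w ∧ r = wexp x} := by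
  refine ⟨w.length, ?_⟩
  rintro r ⟨x, hx, hxw, rfl⟩
  exact (wexp_le_length hx).trans (by exact_mod_cast hxw.length_le)

theorem cubeFree_of_ce_lt {w : List Bool} (h : ce w < 3) :
    CubeFree (fun i => w.getD i false) w.length := by
  intro i p hp hi hc
  have hlen : ((w.drop i).take (3 * p)).length = 3 * p := by
    simp only [List.length_take, List.length_drop]; omega
  have hget : ∀ j < 3 * p, ((w.drop i).take (3 * p)).getD j false = w.getD (i + j) false := by
    intro j hj
    simp [List.getD_eq_getElem?_getD, hj]
  set x := (w.drop i).take (3 * p) with hxdef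
  have hx : x ≠ [] := by
    intro h0; rw [h0] at hlen; simp at hlen; omega
  have hxw : x <:+: w := (List.take_prefix _ _).isInfix.trans (List.drop_suffix _ _).isInfix
  have hper : per x ≤ p := by
    refine Nat.sInf_le ⟨hp, by omega, fun j hj => ?_⟩
    rw [hlen] at hj
    rw [hget j (by omega), hget (j + p) hj, ← add_assoc]
    exact hc j (by omega)
  have h1 := (hasPeriodW_per hx).1
  have h3 : 3 ≤ wexp x := by
    unfold wexp
    rw [hlen, le_div_iff₀ (by exact_mod_cast h1)]
    exact_mod_cast Nat.mul_le_mul_left 3 hper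
  have : wexp x ≤ ce w := le_csSup (bddAbove_wexp w) ⟨x, hx, hxw, rfl⟩
  linarith

theorem ce_lt_of_cubeFree {w : List Bool} (h : CubeFree (fun i => w.getD i false) w.length) :
    ce w < 3 := by
  have hn : (0 : ℝ) < w.length + 1 := by positivity
  have hinv : 1 / ((w.length : ℝ) + 1) ≤ 1 := by
    rw [div_le_one hn]; linarith [(Nat.cast_nonneg w.length : (0 : ℝ) ≤ w.length)]
  have key : ce w ≤ 3 - 1 / ((w.length : ℝ) + 1) := by
    refine Real.sSup_le ?_ (by linarith)
    rintro r ⟨x, hx, hxw, rfl⟩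
    obtain ⟨h1, h2, h3⟩ := hasPeriodW_per hx
    have hlt : x.length < 3 * per x := by
      by_contra hge
      obtain ⟨a, b, rfl⟩ := hxw
      have hg : ∀ j < x.length, (a ++ x ++ b).getD (a.length + j) false = x.getD j false := by
        intro j hj
        rw [List.append_assoc, List.getD_append_right _ _ _ _ (by omega), Nat.add_sub_cancel_left,
          List.getD_append _ _ _ _ hj]
      refine h a.length (per x) h1 (by simp; omega) fun j hj => ?_
      have e1 := hg j (by omega)
      have e2 := hg (j + per x) (by omega)
      rw [← add_assoc] at e2
      simp only [e1, e2]
      exact h3 j (by omega)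
    have hle : per x ≤ w.length + 1 := (h2.trans hxw.length_le).trans (by omega)
    have hp : (0 : ℝ) < per x := by exact_mod_cast h1
    have hlt' : (x.length : ℝ) + 1 ≤ 3 * per x := by exact_mod_cast hlt
    have hle' : (per x : ℝ) ≤ w.length + 1 := by exact_mod_cast hle
    have hdiv : 1 / ((w.length : ℝ) + 1) ≤ 1 / per x := one_div_le_one_div_of_le hp hle'
    have : wexp x ≤ 3 - 1 / per x := by
      unfold wexp
      rw [div_le_iff₀ hp, sub_mul, one_div, inv_mul_cancel₀ hp.ne']
      linarith
    linarith
  have : 0 < 1 / ((w.length : ℝ) + 1) := by positivity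
  linarith

theorem length_applyMorph (s : List Bool) (w : List Bool) :
    (applyMorph s (wcompl s) w).length = s.length * w.length := by
  induction w with
  | nil => simp [applyMorph]
  | cons a w ih =>
    have : applyMorph s (wcompl s) (a :: w) =
        (bif a then wcompl s else s) ++ applyMorph s (wcompl s) w := by
      simp [applyMorph]
    rw [this, List.length_append, ih]
    cases a <;> simp [wcompl] <;> ring

theorem getD_applyMorph (s : List Bool) (w : List Bool) (i : ℕ) (hi : i < s.length * w.length) :
    (applyMorph s (wcompl s) w).getD i false =
      image (fun j => s.getD j false) s.length (fun j => w.getD j false) i := by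
  induction w generalizing i with
  | nil => simp at hi
  | cons a w ih =>
    have happ : applyMorph s (wcompl s) (a :: w) =
        (bif a then wcompl s else s) ++ applyMorph s (wcompl s) w := by
      simp [applyMorph]
    have hl : (bif a then wcompl s else s).length = s.length := by
      cases a <;> simp [wcompl]
    rw [happ]
    rcases lt_or_ge i s.length with h | h
    · rw [List.getD_append _ _ _ _ (by rw [hl]; exact h)]
      simp only [image, Nat.mod_eq_of_lt h, Nat.div_eq_of_lt h, List.getD_cons_zero]
      cases a <;> simp [wcompl, h]
    · obtain ⟨j, rfl⟩ := Nat.exists_eq_add_of_le h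
      have hs : 0 < s.length := by
        rcases Nat.eq_zero_or_pos s.length with h0 | h0
        · simp [h0] at hi
        · exact h0
      rw [List.getD_append_right _ _ _ _ (by rw [hl]; exact h), hl, Nat.add_sub_cancel_left, ih]
      · simp only [image, Nat.add_mod_left, Nat.add_div_left _ hs, List.getD_cons_succ]
      · simp only [List.length_cons, Nat.mul_succ] at hi; omega

theorem CubeFree.congr {u v : ℕ → Bool} {N : ℕ} (h : CubeFree u N) (huv : ∀ i < N, u i = v i) :
    CubeFree v N := by
  intro i p hp hi hc
  refine h i p hp hi fun j hj => ?_
  rw [huv _ (by omega), huv _ (by omega)]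
  exact hc j hj

theorem CubeFreeMorphism.exists_list {s : ℕ → Bool} {k : ℕ} (h : CubeFreeMorphism s k) :
    ∃ h0 : List Bool, h0.length = k ∧ CubefreeC h0 := by
  have hl : ((List.range k).map s).length = k := by simp
  refine ⟨(List.range k).map s, hl, fun w hw => ce_lt_of_cubeFree ?_⟩
  rw [length_applyMorph, hl]
  refine (h _ _ (cubeFree_of_ce_lt hw)).congr fun i hi => ?_
  rw [getD_applyMorph _ _ _ (by rw [hl]; exact hi), hl]
  have hk : 0 < k := Nat.pos_of_mul_pos_right (Nat.zero_lt_of_lt hi)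
  simp [image, Nat.mod_lt i hk]

/-! ### Images under complementary morphisms -/

theorem image_add_mul (s : ℕ → Bool) {k : ℕ} (hk : 0 < k) (w : ℕ → Bool) (i b : ℕ) :
    image s k w (i + k * b) = xor (s (i % k)) (w (i / k + b)) := by
  simp [image, Nat.add_mul_div_left _ _ hk]

theorem image_block (s : ℕ → Bool) {k : ℕ} (w : ℕ → Bool) {i : ℕ} (b : ℕ) (hi : i < k) :
    image s k w (k * b + i) = xor (s i) (w b) := by
  rw [add_comm, image_add_mul s (by omega), Nat.mod_eq_of_lt hi, Nat.div_eq_of_lt hi, zero_add]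

theorem image_block_succ (s : ℕ → Bool) {k : ℕ} (w : ℕ → Bool) {i : ℕ} (b : ℕ)
    (hi : k ≤ i) (hi' : i < 2 * k) :
    image s k w (k * b + i) = xor (s (i - k)) (w (b + 1)) := by
  rw [← image_block s w (b + 1) (show i - k < k by omega), Nat.mul_succ]
  congr 1; omega

theorem image_block_succ_succ (s : ℕ → Bool) {k : ℕ} (w : ℕ → Bool) {i : ℕ} (b : ℕ)
    (hi : 2 * k ≤ i) (hi' : i < 3 * k) :
    image s k w (k * b + i) = xor (s (i - 2 * k)) (w (b + 2)) := by
  rw [← image_block s w (b + 2) (show i - 2 * k < k by omega), Nat.mul_add]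
  congr 1; omega

theorem image_eq_tripleWord (s : ℕ → Bool) {k : ℕ} (w : ℕ → Bool) {c d : Bool} {i : ℕ} (b : ℕ)
    (hi : i < 3 * k) (hc : k ≤ i → c = xor (w b) (w (b + 1)))
    (hd : 2 * k ≤ i → d = xor (w b) (w (b + 2))) :
    image s k w (k * b + i) = xor (w b) (image s k (tripleWord c d) i) := by
  rcases lt_or_ge i k with h | h
  · have := image_block s (tripleWord c d) 0 h
    simp only [mul_zero, zero_add] at this
    rw [image_block s w b h, this]
    simp [tripleWord, Bool.xor_comm]
  rcases lt_or_ge i (2 * k) with h' | h'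
  · have := image_block_succ s (tripleWord c d) 0 h h'
    simp only [mul_zero, zero_add] at this
    rw [image_block_succ s w b h h', this, hc h]
    simp only [tripleWord]
    cases s (i - k) <;> cases w b <;> cases w (b + 1) <;> rfl
  · have := image_block_succ_succ s (tripleWord c d) 0 h' hi
    simp only [mul_zero, zero_add] at this
    rw [image_block_succ_succ s w b h' hi, this, hd h']
    simp only [tripleWord]
    cases s (i - 2 * k) <;> cases w b <;> cases w (b + 2) <;> rfl

theorem CubeFree.image_period_mul {s w : ℕ → Bool} {k N : ℕ} (hw : CubeFree w N) (hk : 0 < k)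
    {i q : ℕ} (hq : 1 ≤ q) (hi : i + 3 * (k * q) ≤ k * N) :
    ¬ ∀ j < 2 * (k * q), image s k w (i + j) = image s k w (i + j + k * q) := by
  intro h
  have hmul : k * (i / k) ≤ i := Nat.mul_div_le i k
  have hN : i / k + 3 * q ≤ N := by
    refine Nat.le_of_mul_le_mul_left ?_ hk
    rw [Nat.mul_add, show k * (3 * q) = 3 * (k * q) by ring]; omega
  refine hw (i / k) q hq hN fun t ht => ?_
  have h1 := h (k * t) (by
    have := Nat.mul_lt_mul_of_pos_left ht hk
    rwa [show k * (2 * q) = 2 * (k * q) by ring] at this)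
  rw [add_assoc i, ← mul_add, image_add_mul s hk, image_add_mul s hk, ← add_assoc] at h1
  exact Bool.xor_right_inj.1 h1

theorem CubeFreeMorphism.comp {s t : ℕ → Bool} {k l : ℕ} (hs : CubeFreeMorphism s k)
    (ht : CubeFreeMorphism t l) : CubeFreeMorphism (image s k t) (k * l) := by
  intro w N hw
  have := hs _ _ (ht w N hw)
  rw [← mul_assoc] at this
  refine this.congr fun i _ => ?_
  simp [image, Nat.mod_mul_right_div_self, Nat.div_div_eq_div_mul]

theorem cubeFreeMorphism_one : CubeFreeMorphism (fun _ => false) 1 := by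
  intro w N hw
  rw [one_mul]
  exact hw.congr fun i _ => by simp [image]

/-! ### The Thue–Morse morphism and word -/

theorem no_odd_period {u : ℕ → Bool} {i p : ℕ} (hp : p % 2 = 1)
    (hu : ∀ j, i ≤ 2 * j → 2 * j + 1 ≤ i + 2 * p → u (2 * j) ≠ u (2 * j + 1)) :
    ¬ ∀ j ≤ p, u (i + j) = u (i + j + p) := by
  intro h
  have hu' : ∀ t, t % 2 = 0 → i ≤ t → t + 1 ≤ i + 2 * p → u t ≠ u (t + 1) := by
    intro t ht h1 h2
    have := hu (t / 2)
    rw [Nat.mul_div_cancel' (Nat.dvd_of_mod_eq_zero ht)] at this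
    exact this h1 h2
  have hadj : ∀ t < p, u (i + t) ≠ u (i + t + 1) := by
    intro t ht
    rcases Nat.mod_two_eq_zero_or_one (i + t) with h0 | h0
    · exact hu' _ h0 (by omega) (by omega)
    · have h1 := hu' (i + t + p) (by omega) (by omega) (by omega)
      rw [h t (by omega), add_assoc i t 1, h (t + 1) (by omega)]
      convert h1 using 2
      ring
  have halt : ∀ t ≤ p, u (i + t) = xor (u i) (decide (t % 2 = 1)) := by
    intro t
    induction t with
    | zero => simp
    | succ t ih =>
      intro ht
      have h1 := hadj t (by omega)
      rw [ih (by omega)] at h1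
      rw [← add_assoc]
      rcases Nat.mod_two_eq_zero_or_one t with h0 | h0
      · have h2 : (t + 1) % 2 = 1 := by omega
        simp only [h0, h2] at h1 ⊢
        revert h1
        cases u i <;> cases u (i + t + 1) <;> simp
      · have h2 : (t + 1) % 2 = 0 := by omega
        simp only [h0, h2] at h1 ⊢
        revert h1
        cases u i <;> cases u (i + t + 1) <;> simp
  have h1 := halt p le_rfl
  have h2 := h 0 (by omega)
  simp only [add_zero] at h2
  rw [h2, hp] at h1
  revert h1
  cases u (i + p) <;> simp

theorem cubeFreeMorphism_two : CubeFreeMorphism (fun n => decide (n % 2 = 1)) 2 := by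
  intro w N hw i p hp hi hc
  rcases Nat.mod_two_eq_zero_or_one p with h0 | h0
  · obtain ⟨q, rfl⟩ := Nat.dvd_of_mod_eq_zero h0
    exact hw.image_period_mul (by norm_num) (by omega) hi hc
  · refine no_odd_period h0 (fun j _ _ => ?_) fun j hj => hc j (by omega)
    have e1 := image_block (fun n => decide (n % 2 = 1)) w j (show 0 < 2 by norm_num)
    have e2 := image_block (fun n => decide (n % 2 = 1)) w j (show 1 < 2 by norm_num)
    rw [add_zero] at e1
    rw [e1, e2]
    cases w j <;> simp

theorem tm_two_mul (n : ℕ) : tm (2 * n) = tm n := by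
  rcases Nat.eq_zero_or_pos n with rfl | h
  · rfl
  · have := Nat.digits_add 2 (by norm_num) 0 n (by norm_num) (Or.inr h.ne')
    rw [zero_add] at this
    simp [tm, this]

theorem tm_two_mul_add_one (n : ℕ) : tm (2 * n + 1) = !tm n := by
  have := Nat.digits_add 2 (by norm_num) 1 n (by norm_num) (Or.inl one_ne_zero)
  rw [add_comm] at this
  simp only [tm, this, List.count_cons_self]
  rcases Nat.mod_two_eq_zero_or_one (List.count 1 (Nat.digits 2 n)) with h | h <;>
    simp [h, Nat.add_mod]

theorem tm_two_pow_mul_add (e q r : ℕ) (hr : r < 2 ^ e) :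
    tm (2 ^ e * q + r) = xor (tm q) (tm r) := by
  induction e generalizing r with
  | zero =>
    obtain rfl : r = 0 := by omega
    simp [tm]
  | succ e ih =>
    rw [pow_succ] at hr
    obtain ⟨t, rfl | rfl⟩ : ∃ t, r = 2 * t ∨ r = 2 * t + 1 := ⟨r / 2, by omega⟩
    · rw [show 2 ^ (e + 1) * q + 2 * t = 2 * (2 ^ e * q + t) by ring, tm_two_mul, tm_two_mul,
        ih t (by omega)]
    · rw [show 2 ^ (e + 1) * q + (2 * t + 1) = 2 * (2 ^ e * q + t) + 1 by ring,
        tm_two_mul_add_one, tm_two_mul_add_one, ih t (by omega)]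
      cases tm q <;> simp

theorem tm_overlapFree (i p : ℕ) (hp : 1 ≤ p) : ¬ ∀ j ≤ p, tm (i + j) = tm (i + j + p) := by
  induction p using Nat.strong_induction_on generalizing i with
  | _ p ih =>
    intro h
    rcases Nat.mod_two_eq_zero_or_one p with h0 | h0
    · obtain ⟨q, rfl⟩ := Nat.dvd_of_mod_eq_zero h0
      refine ih q (by omega) (i / 2) (by omega) fun j hj => ?_
      have h1 := h (2 * j) (by omega)
      rcases Nat.mod_two_eq_zero_or_one i with hi | hi
      · rwa [show i + 2 * j = 2 * (i / 2 + j) by omega, ← mul_add, tm_two_mul, tm_two_mul] at h1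
      · rw [show i + 2 * j = 2 * (i / 2 + j) + 1 by omega,
          show 2 * (i / 2 + j) + 1 + 2 * q = 2 * (i / 2 + j + q) + 1 by ring,
          tm_two_mul_add_one, tm_two_mul_add_one] at h1
        exact Bool.not_inj h1
    · refine no_odd_period h0 (fun j _ _ => ?_) h
      rw [tm_two_mul, tm_two_mul_add_one]
      cases tm j <;> simp

/-- The binary number whose bits are the first 64 letters of the Thue–Morse word. -/
def tmBits : ℕ := 7608434000728254870

theorem testBit_tmBits {n : ℕ} (hn : n < 64) : tmBits.testBit n = tm n := by
  revert n
  decide +kernel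

/-! ### Synchronizing markers -/

/-- A complementary morphism is cubefree if a factor of its image of `0` is a marker, that is, it
occurs (up to complementation) only once per block, and there are no cubes that have a short period
or avoid all markers. -/
theorem cubeFreeMorphism_of_marker {s : ℕ → Bool} {k m x P : ℕ} (hm : 1 ≤ m) (hx : x + m ≤ k)
    (hmP : m ≤ P + 1)
    (huniq : ∀ c d i, i < k →
      (∀ j < m, image s k (tripleWord c true) (i + j) = xor (s (x + j)) d) → i = x)
    (hsmall : ∀ w N, CubeFree w N → ShortCubeFree (image s k w) P (k * N))
    (hlong : ∀ c p o, P < p → x < o → o + 3 * p < k + x + m →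
      ¬ ∀ j < 2 * p, image s k (tripleWord c true) (o + j) =
        image s k (tripleWord c true) (o + j + p)) :
    CubeFreeMorphism s k := by
  intro w N hw i p hp hi hc
  have hk : 0 < k := by omega
  rcases Nat.lt_or_ge P p with hpP | hpP
  swap
  · exact hsmall w N hw i p hp hpP hi hc
  have hpair : ∀ b i, i < 2 * k → image s k w (k * b + i) =
      xor (w b) (image s k (tripleWord (xor (w b) (w (b + 1))) true) i) := fun b i hi =>
    image_eq_tripleWord s w b (by omega) (fun _ => rfl) (by omega)
  have hocc : ∀ b y, (∀ j < m, image s k w (y + j) = image s k w (k * b + x + j)) → y % k = x := by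
    intro b y h
    have hy := Nat.div_add_mod y k
    have hlt := Nat.mod_lt y hk
    refine huniq (xor (w (y / k)) (w (y / k + 1))) (xor (w (y / k)) (w b)) _ hlt fun j hj => ?_
    have h1 := h j hj
    rw [add_assoc, image_block s w b (show x + j < k by omega), ← hy, add_assoc,
      hpair _ _ (by omega)] at h1
    revert h1
    generalize image s k _ _ = A
    cases A <;> cases s (x + j) <;> cases w b <;> cases w (y / k) <;> simp
  have hdvd : k ∣ p → False := by
    rintro ⟨q, rfl⟩
    refine hw.image_period_mul hk (Nat.pos_of_mul_pos_left hp) hi hc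
  obtain ⟨b, hb1, hb2⟩ : ∃ b, i ≤ k * b + x ∧ k * b + x < i + k := by
    refine ⟨(i + (k - 1 - x)) / k, ?_, ?_⟩
    · have h1 := Nat.div_add_mod (i + (k - 1 - x)) k
      have h2 := Nat.mod_lt (i + (k - 1 - x)) hk
      omega
    · have h1 := Nat.mul_div_le (i + (k - 1 - x)) k
      omega
  rcases Nat.lt_or_ge (i + 3 * p) (k * b + x + m) with hend | hend
  · rcases Nat.eq_zero_or_pos b with rfl | hb
    · rw [mul_zero, zero_add] at *
      refine hlong false p (i + k) hpP (by omega) (by omega) fun j hj => ?_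
      have key : ∀ t < k, image s k (tripleWord false true) (k + t) = s t := by
        intro t ht
        have := image_block s (tripleWord false true) 1 ht
        rw [mul_one] at this
        simp [this, tripleWord]
      have key' : ∀ t < k, image s k w t = xor (s t) (w 0) := by
        intro t ht
        simpa using image_block s w 0 ht
      have h1 := hc j hj
      rw [key' _ (by omega), key' _ (by omega)] at h1
      rw [show i + k + j = k + (i + j) by ring, add_assoc k, key _ (by omega), key _ (by omega)]
      exact Bool.xor_left_inj.1 h1
    · obtain ⟨b, rfl⟩ : ∃ c, b = c + 1 := ⟨b - 1, by omega⟩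
      rw [mul_add, mul_one] at *
      refine hlong (xor (w b) (w (b + 1))) p (i - k * b) hpP (by omega) (by omega) fun j hj => ?_
      have h1 := hc j hj
      rw [show i + j = k * b + (i - k * b + j) by omega, add_assoc (k * b), hpair _ _ (by omega),
        hpair _ _ (by omega)] at h1
      exact Bool.xor_right_inj.1 h1
  · have hmod : ∀ y, y % k = x → ∀ t, (y + t) % k = x → k ∣ t := by
      intro y hy t ht
      have : (y + t) % k = (y + 0) % k := by rw [ht, add_zero, hy]
      exact (Nat.modEq_zero_iff_dvd.1 (Nat.ModEq.add_left_cancel' y this))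
    have hb0 : (k * b + x) % k = x := by
      rw [Nat.mul_add_mod, Nat.mod_eq_of_lt (by omega)]
    rcases Nat.lt_or_ge (i + 2 * p) (k * b + x + m) with h2 | h2
    · have h3 := hocc b (k * b + x - p) fun j hj => by
        have h1 := hc (k * b + x - p + j - i) (by omega)
        rw [show i + (k * b + x - p + j - i) = k * b + x - p + j by omega] at h1
        rw [h1]; congr 1; omega
      exact hdvd (hmod _ h3 p (by rw [Nat.sub_add_cancel (by omega)]; exact hb0))
    · have h3 := hocc b (k * b + x + p) fun j hj => by
        have h1 := hc (k * b + x + j - i) (by omega)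
        rw [show i + (k * b + x + j - i) = k * b + x + j by omega] at h1
        rw [h1]; congr 1; omega
      exact hdvd (hmod _ hb0 p h3)

theorem shortCubeFree_image {s : ℕ → Bool} {k P : ℕ} (hk : 0 < k) (hP : 3 * P ≤ 2 * k + 1)
    (h : ∀ c d, (c || d) = true → ShortCubeFree (image s k (tripleWord c d)) P (3 * k))
    (w : ℕ → Bool) (N : ℕ) (hw : CubeFree w N) : ShortCubeFree (image s k w) P (k * N) := by
  intro i p hp hpP hi hc
  have hdm := Nat.div_add_mod i k
  have hlt := Nat.mod_lt i hk
  set b := i / k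
  set o := i % k
  have hle : ∀ t, t * k ≤ o + 3 * p - 1 → b + t < N := by
    intro t ht
    have : k * (b + t) < k * N := by rw [mul_add, mul_comm k t]; omega
    exact Nat.lt_of_mul_lt_mul_left this
  refine h (if b + 1 < N then xor (w b) (w (b + 1)) else true)
    (if b + 2 < N then xor (w b) (w (b + 2)) else true) ?_ o p hp hpP (by omega) fun j hj => ?_
  · split_ifs with h1 h2
    · by_contra hne
      refine hw b 1 le_rfl (by omega) fun j hj => ?_
      obtain rfl | rfl : j = 0 ∨ j = 1 := by omega
      all_goals
        revert hne
        simp only [add_zero, add_assoc, Nat.reduceAdd]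
        cases w b <;> cases w (b + 1) <;> cases w (b + 2) <;> simp
    all_goals simp
  · have key : ∀ t < 3 * p, image s k w (i + t) = xor (w b) (image s k (tripleWord
        (if b + 1 < N then xor (w b) (w (b + 1)) else true)
        (if b + 2 < N then xor (w b) (w (b + 2)) else true)) (o + t)) := by
      intro t ht
      rw [← hdm, add_assoc]
      refine image_eq_tripleWord s w b (by omega) (fun h1 => ?_) fun h1 => ?_
      · rw [if_pos (hle 1 (by omega))]
      · rw [if_pos (hle 2 (by omega))]
    have h1 := hc j hj
    rw [key j (by omega), add_assoc i, key (j + p) (by omega), ← add_assoc] at h1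
    exact Bool.xor_right_inj.1 h1

/-! ### Checking words packed into natural numbers -/

/-- The number whose `i`-th bit is `u i` for `i < n`, and `false` for `i ≥ n`. -/
def packBits (u : ℕ → Bool) : ℕ → ℕ
  | 0 => 0
  | n + 1 => packBits u n ||| ((u n).toNat <<< n)

theorem testBit_packBits (u : ℕ → Bool) (n i : ℕ) :
    (packBits u n).testBit i = (decide (i < n) && u i) := by
  induction n with
  | zero => simp [packBits]
  | succ n ih =>
    rw [packBits, Nat.testBit_or, ih, Nat.testBit_shiftLeft]
    rcases lt_trichotomy i n with h | rfl | h
    · simp [h, h.trans (Nat.lt_succ_self n), Nat.not_le.2 h]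
    · cases u i <;> simp
    · obtain ⟨t, rfl⟩ := Nat.exists_eq_add_of_lt h
      rw [show n + t + 1 - n = t + 1 by omega]
      have : ¬ n + t + 1 < n := by omega
      cases u n <;> simp [Nat.testBit_succ, this]

/-- The disjunction of the first `n` right shifts of `D`. -/
def orShifts (D : ℕ) : ℕ → ℕ
  | 0 => 0
  | n + 1 => orShifts D n ||| (D >>> n)

theorem testBit_orShifts_eq_false {D n i : ℕ} (h : ∀ j < n, D.testBit (i + j) = false) :
    (orShifts D n).testBit i = false := by
  induction n with
  | zero => simp [orShifts]
  | succ n ih =>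
    rw [orShifts, Nat.testBit_or, ih fun j hj => h j (by omega), Nat.testBit_shiftRight,
      add_comm, h n (by omega)]
    rfl

/-- The first `L` bits of `X` contain no cube whose period is at most `P`. -/
def noCubes (X P L : ℕ) : Bool :=
  (List.range P).all fun p =>
    orShifts (X ^^^ (X >>> (p + 1))) (2 * (p + 1)) % 2 ^ (L + 1 - 3 * (p + 1)) ==
      2 ^ (L + 1 - 3 * (p + 1)) - 1

theorem shortCubeFree_of_noCubes {u : ℕ → Bool} {P L : ℕ}
    (h : noCubes (packBits u L) P L = true) : ShortCubeFree u P L := by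
  intro i p hp hpP hi hc
  rw [noCubes, List.all_eq_true] at h
  have h1 := h (p - 1) (by simp; omega)
  rw [Nat.sub_add_cancel hp, beq_iff_eq] at h1
  have h2 := congrArg (fun n => n.testBit i) h1
  simp only [Nat.testBit_mod_two_pow, Nat.testBit_two_pow_sub_one] at h2
  rw [testBit_orShifts_eq_false fun j hj => ?_] at h2
  · simp at h2; omega
  · rw [Nat.testBit_xor, Nat.testBit_shiftRight, testBit_packBits, testBit_packBits, hc j hj,
      add_comm p]
    simp [show i + j < L by omega, show i + j + p < L by omega]

/-- The factor of length `m` of `v` starting at `x` and its complement occur in the first `L`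
letters of `u` at no position `i < n` other than `y`. -/
def occursOnlyAt (u v : ℕ → Bool) (m x y n L : ℕ) : Bool :=
  (List.range n).all fun i => i == y ||
    !(((packBits u L) >>> i) % 2 ^ m == packBits (fun j => v (x + j)) m ||
      ((packBits u L) >>> i) % 2 ^ m == packBits (fun j => !v (x + j)) m)

theorem eq_of_occursOnlyAt {u v : ℕ → Bool} {m x y n L i : ℕ}
    (h : occursOnlyAt u v m x y n L = true) (hi : i < n) (hL : i + m ≤ L) (d : Bool)
    (hu : ∀ j < m, u (i + j) = xor (v (x + j)) d) : i = y := by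
  rw [occursOnlyAt, List.all_eq_true] at h
  have h1 := h i (List.mem_range.2 hi)
  by_contra hne
  have hbits : ∀ f : ℕ → Bool, (∀ j < m, u (i + j) = f j) →
      ((packBits u L) >>> i) % 2 ^ m = packBits f m := by
    intro f hf
    refine Nat.eq_of_testBit_eq fun j => ?_
    rw [Nat.testBit_mod_two_pow, Nat.testBit_shiftRight, testBit_packBits, testBit_packBits]
    rcases Nat.lt_or_ge j m with hj | hj
    · simp [hj, hf j hj, show i + j < L by omega]
    · simp [Nat.not_lt.2 hj]
  cases d
  · simp [hne, hbits (fun j => v (x + j)) fun j hj => by simpa using hu j hj] at h1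
  · simp [hne, hbits (fun j => !v (x + j)) fun j hj => by simpa using hu j hj] at h1

/-! ### Morphisms of small length -/

/-- A computable criterion for the cubefreeness of a complementary morphism of length `k`. -/
def blockCheck (s : ℕ → Bool) (k m x P : ℕ) : Bool :=
  ([false, true].all fun c => occursOnlyAt (image s k (tripleWord c true)) s m x x k (2 * k)) &&
  [(false, true), (true, false), (true, true)].all fun c =>
    noCubes (packBits (image s k (tripleWord c.1 c.2)) (3 * k)) P (3 * k)

theorem cubeFreeMorphism_of_blockCheck {s : ℕ → Bool} {k : ℕ} (m x P : ℕ) (hm : 1 ≤ m)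
    (hx : x + m ≤ k) (hmP : m ≤ P + 1) (hP : k + m ≤ 3 * P + 4) (hPk : 3 * P ≤ 2 * k + 1)
    (h : blockCheck s k m x P = true) : CubeFreeMorphism s k := by
  rw [blockCheck, Bool.and_eq_true, List.all_eq_true, List.all_eq_true] at h
  refine cubeFreeMorphism_of_marker hm hx hmP (fun c d i hi hj => ?_)
    (shortCubeFree_image (by omega) hPk fun c d hcd => ?_) fun c p o hp hxo ho => ?_
  · exact eq_of_occursOnlyAt (h.1 c (by cases c <;> simp)) hi (by omega) d hj
  · refine shortCubeFree_of_noCubes (h.2 (c, d) ?_)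
    cases c <;> cases d <;> simp at hcd ⊢
  · omega

/-! ### Morphisms built from the Thue–Morse word -/

/-- The word consisting of the first `a` bits of `F`, followed by the Thue–Morse word. -/
def tmTail (F a n : ℕ) : Bool := if n < a then F.testBit n else tm (n - a)

/-- The initial part of `tmTail F a`, in a form suited to computation. -/
def tmTailBits (F a n : ℕ) : Bool := if n < a then F.testBit n else tmBits.testBit (n - a)

/-- Up to complementation, the neighbourhood of a boundary between the images of two letters,
starting 52 letters before this boundary. -/
def boundary (F a r : ℕ) (e c : Bool) (n : ℕ) : Bool :=
  if n < 52 then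
    if 52 ≤ 4 * r + n then tmBits.testBit (4 * r + n - 52)
    else xor e (tmBits.testBit (4 * r + n + 12))
  else xor c (tmTailBits F a (n - 52))

theorem tmTail_eq_boundary {F a n : ℕ} (hn : n < a + 52) :
    tmTail F a n = boundary F a 0 false false (52 + n) := by
  simp only [tmTail, boundary, tmTailBits, show ¬ 52 + n < 52 by omega, if_false,
    Nat.add_sub_cancel_left, Bool.false_xor]
  split_ifs
  · rfl
  · rw [testBit_tmBits (by omega)]

theorem tmTail_boundary {F a n i : ℕ} (hn : 13 ≤ n) (c : Bool) (hi : i < 52) :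
    tmTail F a (a + 4 * n - 52 + i) = xor (tm (n / 16))
      (boundary F a (n % 16) (xor (tm (n / 16)) (tm (n / 16 - 1))) c i) := by
  simp only [tmTail, boundary, hi, if_true, show ¬ a + 4 * n - 52 + i < a by omega, if_false]
  split_ifs with h
  · rw [testBit_tmBits (by omega), ← tm_two_pow_mul_add 6 _ _ (by norm_num; omega)]
    congr 1; omega
  · rw [testBit_tmBits (by omega), ← Bool.xor_assoc, ← Bool.xor_assoc, Bool.xor_self,
      Bool.false_xor, ← tm_two_pow_mul_add 6 _ _ (by norm_num; omega)]
    congr 1; omega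

/-- A computable criterion for the cubefreeness of the morphisms given by `tmTail F a`. -/
def boundaryCheck (F a m x P : ℕ) : Bool :=
  (List.range 16).all fun r => [false, true].all fun e => [false, true].all fun c =>
    noCubes (packBits (boundary F a r e c) (a + 104)) P (a + 104) &&
      occursOnlyAt (boundary F a r e c) F.testBit m x (52 + x) (52 + a) (a + 104)

theorem cubeFreeMorphism_tmTail_of_large {F a : ℕ} (m x P n : ℕ) (hn : 13 ≤ n) (hm : 2 ≤ m)
    (hx : x + m ≤ a) (hmP : m ≤ P + 1) (haP : a + m ≤ P + 3) (hP : 3 * P ≤ 52) (hm52 : m ≤ 52)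
    (htm : ∀ i d, ¬ ∀ j < m, tm (i + j) = xor (F.testBit (x + j)) d)
    (h : boundaryCheck F a m x P = true) : CubeFreeMorphism (tmTail F a) (a + 4 * n) := by
  have hcheck : ∀ r < 16, ∀ e c, ShortCubeFree (boundary F a r e c) P (a + 104) ∧
      occursOnlyAt (boundary F a r e c) F.testBit m x (52 + x) (52 + a) (a + 104) = true := by
    intro r hr e c
    simp only [boundaryCheck, List.all_eq_true, Bool.and_eq_true] at h
    have h1 := h r (List.mem_range.2 hr) e (by cases e <;> simp) c (by cases c <;> simp)
    exact ⟨shortCubeFree_of_noCubes h1.1, h1.2⟩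
  set k := a + 4 * n with hk
  have htail : ∀ i, a ≤ i → tmTail F a i = tm (i - a) := fun i hi => by
    simp [tmTail, Nat.not_lt.2 hi]
  have hhead : ∀ i < a, tmTail F a i = F.testBit i := fun i hi => by simp [tmTail, hi]
  have hr : n % 16 < 16 := Nat.mod_lt _ (by norm_num)
  have himage : ∀ (w : ℕ → Bool) b o, k ≤ o + 52 → o < k + a + 52 →
      image (tmTail F a) k w (k * b + o) = xor (xor (w b) (tm (n / 16)))
        (boundary F a (n % 16) (xor (tm (n / 16)) (tm (n / 16 - 1)))
          (xor (xor (w b) (w (b + 1))) (tm (n / 16))) (o + 52 - k)) := by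
    intro w b o h1 h2
    rcases Nat.lt_or_ge o k with ho | ho
    · rw [image_block _ w b ho]
      conv_lhs => rw [show o = a + 4 * n - 52 + (o + 52 - k) by omega]
      rw [tmTail_boundary hn (xor (xor (w b) (w (b + 1))) (tm (n / 16))) (by omega)]
      generalize boundary _ _ _ _ _ _ = B
      cases w b <;> cases tm (n / 16) <;> simp
    · rw [image_block_succ _ w b ho (by omega), tmTail_eq_boundary (by omega)]
      simp only [boundary, show ¬ 52 + (o - k) < 52 by omega, show ¬ o + 52 - k < 52 by omega,
        if_false, show 52 + (o - k) - 52 = o + 52 - k - 52 by omega]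
      cases w b <;> cases w (b + 1) <;> cases tm (n / 16) <;> simp
  refine cubeFreeMorphism_of_marker (x := x) (P := P) (by omega) (by omega) hmP
    (fun c d i hi hj => ?_) (fun w N hw i p hp hpP hi hc => ?_) fun c p o hp hxo ho hc => ?_
  · have hj' : ∀ j < m, image (tmTail F a) k (tripleWord c true) (i + j) =
        xor (F.testBit (x + j)) d := fun j hjm => by rw [hj j hjm, hhead _ (by omega)]
    have hin : ∀ j < k, image (tmTail F a) k (tripleWord c true) j = tmTail F a j := fun j hj => by
      have := image_block (tmTail F a) (tripleWord c true) 0 hj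
      simpa [tripleWord] using this
    rcases Nat.lt_or_ge i a with hia | hia
    · have := eq_of_occursOnlyAt (i := 52 + i) (hcheck 0 (by norm_num) false false).2 (by omega)
        (by omega) d fun j hjm => by
          rw [← hj' j hjm, hin _ (by omega), tmTail_eq_boundary (by omega), add_assoc]
      omega
    rcases Nat.lt_or_ge k (i + m) with him | him
    · have := eq_of_occursOnlyAt (i := i + 52 - k) (hcheck _ hr _ _).2 (by omega) (by omega)
        (xor d (tm (n / 16))) fun j hjm => by
          have h1 := himage (tripleWord c true) 0 (i + j) (by omega) (by omega)
          rw [mul_zero, zero_add, hj' j hjm, show i + j + 52 - k = i + 52 - k + j by omega] at h1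
          rw [← Bool.xor_assoc, h1]
          simp only [tripleWord, if_true, Bool.false_xor]
          rw [Bool.xor_comm (tm (n / 16)), Bool.xor_assoc, Bool.xor_self, Bool.xor_false]
      omega
    · refine (htm (i - a) d fun j hjm => ?_).elim
      rw [← hj' j hjm, hin _ (by omega), htail _ (by omega)]
      congr 1; omega
  · have hk0 : 0 < k := by omega
    have hdm := Nat.div_add_mod i k
    have hlt := Nat.mod_lt i hk0
    set b := i / k
    set o := i % k
    have hc' : ∀ j < 2 * p, image (tmTail F a) k w (k * b + (o + j)) =
        image (tmTail F a) k w (k * b + (o + j + p)) := fun j hj => by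
      have h1 := hc j hj
      rwa [← hdm, add_assoc, add_assoc, add_assoc, ← add_assoc o] at h1
    rcases Nat.lt_or_ge o a with hoa | hoa
    · refine (hcheck 0 (by norm_num) false false).1 (52 + o) p hp hpP (by omega) fun j hj => ?_
      have h1 := hc' j hj
      rw [image_block _ w b (by omega), image_block _ w b (by omega),
        tmTail_eq_boundary (by omega), tmTail_eq_boundary (by omega)] at h1
      rw [add_assoc 52, add_assoc 52]
      exact Bool.xor_left_inj.1 h1
    rcases Nat.lt_or_ge k (o + 3 * p) with hok | hok
    · refine (hcheck _ hr (xor (tm (n / 16)) (tm (n / 16 - 1)))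
        (xor (xor (w b) (w (b + 1))) (tm (n / 16)))).1 (o + 52 - k) p hp hpP (by omega)
        fun j hj => ?_
      have h1 := hc' j hj
      rw [himage w b _ (by omega) (by omega), himage w b _ (by omega) (by omega),
        show o + j + 52 - k = o + 52 - k + j by omega,
        show o + j + p + 52 - k = o + 52 - k + j + p by omega] at h1
      exact Bool.xor_right_inj.1 h1
    · refine tm_overlapFree (o - a) p hp fun j hj => ?_
      have h1 := hc' j (by omega)
      rw [image_block _ w b (by omega), image_block _ w b (by omega), htail _ (by omega),
        htail _ (by omega), show o + j - a = o - a + j by omega,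
        show o + j + p - a = o - a + j + p by omega] at h1
      exact Bool.xor_left_inj.1 h1
  · have hin : ∀ j < k, image (tmTail F a) k (tripleWord c true) j = tmTail F a j := fun j hj => by
      have := image_block (tmTail F a) (tripleWord c true) 0 hj
      simpa [tripleWord] using this
    obtain ⟨t, hot, hat, ht⟩ : ∃ t, o ≤ t ∧ a ≤ t ∧ (t = o ∨ t = a) :=
      ⟨max o a, le_max_left _ _, le_max_right _ _, max_choice _ _⟩
    refine tm_overlapFree (t - a) p (by omega) fun j hj => ?_
    have h1 := hc (t - o + j) (by omega)
    rw [show o + (t - o + j) = t + j by omega, hin _ (by omega), hin _ (by omega),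
      htail _ (by omega), htail _ (by omega), show t + j - a = t - a + j by omega,
      show t + j + p - a = t - a + j + p by omega] at h1
    exact h1

theorem tmTail_eq_tmTailBits {F a n : ℕ} (hn : n < a + 64) : tmTail F a n = tmTailBits F a n := by
  simp only [tmTail, tmTailBits]
  split_ifs
  · rfl
  · rw [testBit_tmBits (by omega)]

theorem CubeFreeMorphism.congr {s t : ℕ → Bool} {k : ℕ} (h : CubeFreeMorphism s k)
    (hst : ∀ i < k, s i = t i) : CubeFreeMorphism t k := by
  intro w N hw
  refine (h w N hw).congr fun i hi => ?_
  have hk : 0 < k := Nat.pos_of_mul_pos_right (Nat.zero_lt_of_lt hi)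
  simp [image, hst _ (Nat.mod_lt i hk)]

theorem tm_avoids (F x : ℕ) (hF : ∀ r < 8, ∀ e d : Bool, ∃ j < 7,
      (if r + j < 8 then tmBits.testBit (r + j) else xor e (tmBits.testBit (r + j - 8))) ≠
        xor (F.testBit (x + j)) d) (i : ℕ) (d : Bool) :
    ¬ ∀ j < 7, tm (i + j) = xor (F.testBit (x + j)) d := by
  intro h
  obtain ⟨j, hj, hne⟩ := hF (i % 8) (Nat.mod_lt _ (by norm_num))
    (xor (tm (i / 8)) (tm (i / 8 + 1))) (xor (tm (i / 8)) d)
  have h1 := h j hj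
  apply hne
  split_ifs with hlt
  · rw [show i + j = 2 ^ 3 * (i / 8) + (i % 8 + j) by omega,
      tm_two_pow_mul_add 3 _ _ (by norm_num; omega)] at h1
    rw [testBit_tmBits (by omega)]
    revert h1
    cases tm (i / 8) <;> cases F.testBit (x + j) <;> cases d <;> simp
  · rw [show i + j = 2 ^ 3 * (i / 8 + 1) + (i % 8 + j - 8) by omega,
      tm_two_pow_mul_add 3 _ _ (by norm_num; omega)] at h1
    rw [testBit_tmBits (by omega)]
    revert h1
    cases tm (i / 8) <;> cases tm (i / 8 + 1) <;> cases F.testBit (x + j) <;> cases d <;> simp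

theorem cubeFreeMorphism_tmTail_eleven {n : ℕ} (hn : 2 ≤ n) :
    CubeFreeMorphism (tmTail 1458 11) (11 + 4 * n) := by
  rcases Nat.lt_or_ge n 13 with h | h
  · have hcheck : ∀ n < 13, 2 ≤ n →
        blockCheck (tmTailBits 1458 11) (11 + 4 * n) 7 4 ((16 + 4 * n) / 3) = true := by
      decide +kernel
    refine (cubeFreeMorphism_of_blockCheck 7 4 _ (by omega) (by omega) (by omega) (by omega)
      (by omega) (hcheck n h hn)).congr fun i hi => ?_
    rw [tmTail_eq_tmTailBits (by omega)]
  · exact cubeFreeMorphism_tmTail_of_large 7 4 15 n h (by norm_num) (by norm_num) (by norm_num)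
      (by norm_num) (by norm_num) (by norm_num) (tm_avoids _ _ (by decide +kernel))
      (by decide +kernel)

theorem cubeFreeMorphism_tmTail_thirteen {n : ℕ} (hn : 1 ≤ n) :
    CubeFreeMorphism (tmTail 2637 13) (13 + 4 * n) := by
  rcases Nat.lt_or_ge n 13 with h | h
  · have hcheck : ∀ n < 13, 1 ≤ n →
        blockCheck (tmTailBits 2637 13) (13 + 4 * n) 7 4 ((18 + 4 * n) / 3) = true := by
      decide +kernel
    refine (cubeFreeMorphism_of_blockCheck 7 4 _ (by omega) (by omega) (by omega) (by omega)
      (by omega) (hcheck n h hn)).congr fun i hi => ?_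
    rw [tmTail_eq_tmTailBits (by omega)]
  · exact cubeFreeMorphism_tmTail_of_large 7 4 17 n h (by norm_num) (by norm_num) (by norm_num)
      (by norm_num) (by norm_num) (by norm_num) (tm_avoids _ _ (by decide +kernel))
      (by decide +kernel)

/-! ### All lengths -/

theorem exists_cubeFreeMorphism_of_odd {k : ℕ} (hk : k % 2 = 1) (h3 : k ≠ 3) :
    ∃ s, CubeFreeMorphism s k := by
  rcases Nat.lt_or_ge k 17 with h | h
  · obtain rfl | rfl | rfl | rfl | rfl | rfl | rfl :
        k = 1 ∨ k = 5 ∨ k = 7 ∨ k = 9 ∨ k = 11 ∨ k = 13 ∨ k = 15 := by omega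
    · exact ⟨_, cubeFreeMorphism_one⟩
    · exact ⟨Nat.testBit 18, cubeFreeMorphism_of_blockCheck 4 0 3 (by norm_num) (by norm_num)
        (by norm_num) (by norm_num) (by norm_num) (by decide +kernel)⟩
    · exact ⟨Nat.testBit 50, cubeFreeMorphism_of_blockCheck 4 0 3 (by norm_num) (by norm_num)
        (by norm_num) (by norm_num) (by norm_num) (by decide +kernel)⟩
    · exact ⟨Nat.testBit 210, cubeFreeMorphism_of_blockCheck 6 2 5 (by norm_num) (by norm_num)
        (by norm_num) (by norm_num) (by norm_num) (by decide +kernel)⟩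
    · exact ⟨Nat.testBit 1234, cubeFreeMorphism_of_blockCheck 6 0 5 (by norm_num) (by norm_num)
        (by norm_num) (by norm_num) (by norm_num) (by decide +kernel)⟩
    · exact ⟨Nat.testBit 3282, cubeFreeMorphism_of_blockCheck 6 0 5 (by norm_num) (by norm_num)
        (by norm_num) (by norm_num) (by norm_num) (by decide +kernel)⟩
    · exact ⟨Nat.testBit 13522, cubeFreeMorphism_of_blockCheck 7 6 6 (by norm_num) (by norm_num)
        (by norm_num) (by norm_num) (by norm_num) (by decide +kernel)⟩
  · rcases Nat.lt_or_ge (k % 4) 2 with h4 | h4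
    · obtain ⟨n, hn, rfl⟩ : ∃ n, 1 ≤ n ∧ k = 13 + 4 * n := ⟨(k - 13) / 4, by omega, by omega⟩
      exact ⟨_, cubeFreeMorphism_tmTail_thirteen hn⟩
    · obtain ⟨n, hn, rfl⟩ : ∃ n, 2 ≤ n ∧ k = 11 + 4 * n := ⟨(k - 11) / 4, by omega, by omega⟩
      exact ⟨_, cubeFreeMorphism_tmTail_eleven hn⟩

theorem exists_cubeFreeMorphism {k : ℕ} (hk : 1 ≤ k) (h3 : k ≠ 3) (h6 : k ≠ 6) :
    ∃ s, CubeFreeMorphism s k := by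
  induction k using Nat.strong_induction_on with
  | _ k ih =>
    rcases Nat.mod_two_eq_zero_or_one k with h | h
    · by_cases h12 : k = 12
      · subst h12
        exact ⟨Nat.testBit 1618, cubeFreeMorphism_of_blockCheck 6 0 5 (by norm_num) (by norm_num)
          (by norm_num) (by norm_num) (by norm_num) (by decide +kernel)⟩
      · obtain ⟨l, rfl⟩ := Nat.dvd_of_mod_eq_zero h
        obtain ⟨s, hs⟩ := ih l (by omega) (by omega) (by omega) (by omega)
        exact ⟨_, cubeFreeMorphism_two.comp hs⟩
    · exact exists_cubeFreeMorphism_of_odd h h3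

/-- for every integer `k ≥ 1` with `k ≠ 3` and `k ≠ 6`, there is
a cubefree complementary binary morphism of length `k`. -/
theorem stmt17 (k : ℕ) (hk : 1 ≤ k) (h3 : k ≠ 3) (h6 : k ≠ 6) :
    ∃ h0 : List Bool, h0.length = k ∧ CubefreeC h0 := by
  obtain ⟨s, hs⟩ := exists_cubeFreeMorphism hk h3 h6
  exact hs.exists_list
end

section
/- For every real number α with 1 < α < 3, there is no α-free binary morphism that is 3-uniform or 6-uniform, and no α^+-free binary morphism that is 3-uniform or 6-uniform. That is, if h is a binary morphism with |h(0)| = |h(1)| = k for k ∈ {3, 6}, then there exists a finite binary word w with ce(w) < α and ce(h(w)) ≥ α, and there exists a finite binary word w′ with ce(w′) ≤ α and ce(h(w′)) > α. -/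
/-- `u` and `v` agree on their first `n` positions. -/
def agreeAtStart : ℕ → List Bool → List Bool → Bool
  | 0, _, _ => true
  | n + 1, a :: u, b :: v => a == b && agreeAtStart n u v
  | _, _, _ => false

/-- `u` and `v` agree on `n` consecutive positions. -/
def agreeSomewhere (n : ℕ) : List Bool → List Bool → Bool
  | a :: u, b :: v => agreeAtStart n (a :: u) (b :: v) || agreeSomewhere n u v
  | u, v => agreeAtStart n u v

theorem agreeAtStart_iff {n : ℕ} {u v : List Bool} :
    agreeAtStart n u v = true ↔
      n ≤ u.length ∧ n ≤ v.length ∧ ∀ j < n, u.getD j false = v.getD j false := by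
  induction n generalizing u v with
  | zero => simp [agreeAtStart]
  | succ n ih =>
    rcases u with _ | ⟨a, u⟩
    · simp [agreeAtStart]
    rcases v with _ | ⟨b, v⟩
    · simp [agreeAtStart]
    simp only [agreeAtStart, Bool.and_eq_true, beq_iff_eq, ih, List.length_cons,
      Nat.add_le_add_iff_right, Nat.forall_lt_succ_left, List.getD_cons_zero, List.getD_cons_succ]
    tauto

theorem agreeSomewhere_iff {n : ℕ} {u v : List Bool} :
    agreeSomewhere n u v = true ↔ ∃ i, i + n ≤ u.length ∧ i + n ≤ v.length ∧
      ∀ j < n, u.getD (i + j) false = v.getD (i + j) false := by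
  have hzero : ∀ {u v : List Bool}, (u = [] ∨ v = []) →
      (agreeAtStart n u v = true ↔ ∃ i, i + n ≤ u.length ∧ i + n ≤ v.length ∧
        ∀ j < n, u.getD (i + j) false = v.getD (i + j) false) := by
    intro u v h
    rw [agreeAtStart_iff]
    refine ⟨fun h => ⟨0, by simpa using h⟩, ?_⟩
    rintro ⟨i, h1, h2, h3⟩
    obtain rfl : i = 0 := by rcases h with rfl | rfl <;> simp at h1 h2 <;> omega
    simpa only [zero_add] using And.intro h1 (And.intro h2 h3)
  induction u generalizing v with
  | nil => simpa only [agreeSomewhere] using hzero (Or.inl rfl)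
  | cons a u ih =>
    rcases v with _ | ⟨b, v⟩
    · simpa only [agreeSomewhere] using hzero (Or.inr rfl)
    rw [agreeSomewhere, Bool.or_eq_true, agreeAtStart_iff]
    constructor
    · rintro (h | h)
      · exact ⟨0, by simpa using h⟩
      · obtain ⟨i, h1, h2, h3⟩ := ih.mp h
        refine ⟨i + 1, by simp; omega, by simp; omega, fun j hj => ?_⟩
        rw [add_right_comm, List.getD_cons_succ, List.getD_cons_succ]
        exact h3 j hj
    · rintro ⟨_ | i, h1, h2, h3⟩
      · exact Or.inl (by simpa only [zero_add] using And.intro h1 (And.intro h2 h3))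
      · refine Or.inr (ih.mpr ⟨i, by simp at h1; omega, by simp at h2; omega, fun j hj => ?_⟩)
        have := h3 j hj
        rwa [add_right_comm, List.getD_cons_succ, List.getD_cons_succ] at this

/-- `u` has a factor of length `ℓ ≥ q` in which letters at distance `q` agree. -/
def hasRep (u : List Bool) (ℓ q : ℕ) : Bool :=
  decide (ℓ ≤ u.length) && agreeSomewhere (ℓ - q) u (u.drop q)

theorem hasRep_iff {u : List Bool} {ℓ q : ℕ} (hq : q ≤ ℓ) :
    hasRep u ℓ q = true ↔ ∃ i, i + ℓ ≤ u.length ∧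
      ∀ j < ℓ - q, u.getD (i + j) false = u.getD (i + j + q) false := by
  have hdrop : ∀ m, (u.drop q).getD m false = u.getD (m + q) false := fun m => by
    simp [List.getD_eq_getElem?_getD, List.getElem?_drop, add_comm]
  simp only [hasRep, Bool.and_eq_true, decide_eq_true_eq, agreeSomewhere_iff, hdrop,
    List.length_drop]
  constructor
  · rintro ⟨h, i, -, h2, H⟩
    exact ⟨i, by omega, H⟩
  · rintro ⟨i, h, H⟩
    exact ⟨by omega, i, by omega, by omega, H⟩

theorem hasRep_anti {u : List Bool} {ℓ ℓ' q : ℕ} (hq : q ≤ ℓ') (h : ℓ' ≤ ℓ)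
    (hu : hasRep u ℓ q = true) : hasRep u ℓ' q = true := by
  rw [hasRep_iff hq]
  rw [hasRep_iff (hq.trans h)] at hu
  obtain ⟨i, hi, H⟩ := hu
  exact ⟨i, by omega, fun j hj => H j (by omega)⟩

theorem getD_append_middle (s x t : List Bool) {j : ℕ} (hj : j < x.length) :
    (s ++ x ++ t).getD (s.length + j) false = x.getD j false := by
  rw [List.append_assoc, List.getD_append_right _ _ _ _ (by omega),
    List.getD_append _ _ _ _ (by omega)]
  congr 1
  omega

theorem ce_le {u : List Bool} {r : ℝ} (hr : 0 ≤ r)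
    (h : ∀ ℓ q, 1 ≤ q → q ≤ ℓ → hasRep u ℓ q = true → (ℓ : ℝ) ≤ r * q) : ce u ≤ r := by
  refine Real.sSup_le ?_ hr
  rintro _ ⟨x, hx, ⟨s, t, rfl⟩, rfl⟩
  obtain ⟨h1, h2, h3⟩ := hasPeriodW_per hx
  have hpos : (0 : ℝ) < per x := by exact_mod_cast h1
  rw [wexp, div_le_iff₀ hpos]
  refine h _ _ h1 h2 ((hasRep_iff h2).mpr ⟨s.length, by simp, fun j hj => ?_⟩)
  rw [add_assoc, getD_append_middle _ _ _ (by omega), getD_append_middle _ _ _ (by omega)]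
  exact h3 j (by omega)

theorem wexp_le_ce {x u : List Bool} (hx : x ≠ []) (hxu : x <:+: u) : wexp x ≤ ce u := by
  refine le_csSup ⟨u.length, ?_⟩ ⟨x, hx, hxu, rfl⟩
  rintro _ ⟨y, hy, hyu, rfl⟩
  have h1 : (1 : ℝ) ≤ per y := by exact_mod_cast (hasPeriodW_per hy).1
  have h2 : (y.length : ℝ) ≤ u.length := by exact_mod_cast hyu.length_le
  exact (div_le_self (by positivity) h1).trans h2

theorem le_ce {u : List Bool} {ℓ q : ℕ} (hq : 1 ≤ q) (hℓ : q ≤ ℓ) (h : hasRep u ℓ q = true) :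
    (ℓ : ℝ) / q ≤ ce u := by
  obtain ⟨i, hi, H⟩ := (hasRep_iff hℓ).mp h
  set x := (u.drop i).take ℓ with hxdef
  have hlen : x.length = ℓ := by simp [hxdef]; omega
  have hx : x ≠ [] := by
    rw [← List.length_pos_iff]; omega
  have hxu : x <:+: u := (List.take_prefix _ _).isInfix.trans (List.drop_suffix _ _).isInfix
  have hget : ∀ j < ℓ, x.getD j false = u.getD (i + j) false := by
    intro j hj
    simp [hxdef, List.getD_eq_getElem?_getD, List.getElem?_drop, hj]
  have hper : HasPeriodW x q := by
    refine ⟨hq, by omega, fun j hj => ?_⟩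
    rw [hget _ (by omega), hget _ (by omega), ← add_assoc]
    exact H j (by omega)
  refine le_trans ?_ (wexp_le_ce hx hxu)
  rw [wexp, hlen]
  have hle : per x ≤ q := Nat.sInf_le hper
  have hpos : (0 : ℝ) < per x := by exact_mod_cast (hasPeriodW_per hx).1
  gcongr

theorem ce_le_of_hasRep_eq_false {u : List Bool} (N D : ℕ) (hD : 0 < D) (hDN : D ≤ N)
    (h : (List.range u.length).all
      (fun q => !hasRep u (N * (q + 1) / D + 1) (q + 1)) = true) :
    ce u ≤ (N : ℝ) / D := by
  refine ce_le (by positivity) fun ℓ q hq hqℓ hrep => ?_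
  have hD' : (0 : ℝ) < D := by exact_mod_cast hD
  by_contra! hlt
  rw [div_mul_eq_mul_div, div_lt_iff₀ hD'] at hlt
  have hlt' : N * q < ℓ * D := by exact_mod_cast hlt
  obtain ⟨i, hi, -⟩ := (hasRep_iff hqℓ).mp hrep
  obtain ⟨r, rfl⟩ : ∃ r, q = r + 1 := ⟨q - 1, by omega⟩
  have hle : r + 1 ≤ N * (r + 1) / D :=
    (Nat.le_div_iff_mul_le hD).mpr (by rw [mul_comm]; exact Nat.mul_le_mul_right _ hDN)
  have := hasRep_anti (hle.trans (Nat.le_succ _)) (Nat.div_lt_of_lt_mul (by rwa [mul_comm D])) hrep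
  have hr := List.all_eq_true.mp h r (List.mem_range.mpr (by omega))
  simp [this] at hr

section Morphism

theorem length_applyMorph_s18 {g0 g1 : List Bool} {k : ℕ} (h0 : g0.length = k) (h1 : g1.length = k)
    (w : List Bool) : (applyMorph g0 g1 w).length = k * w.length := by
  induction w with
  | nil => simp [applyMorph]
  | cons a w ih =>
    simp only [applyMorph, List.map_cons, List.flatten_cons, List.length_append,
      List.length_cons] at ih ⊢
    rw [ih]
    cases a <;> simp [h0, h1] <;> ring

theorem getD_applyMorph_s18 {g0 g1 : List Bool} {k : ℕ} (h0 : g0.length = k) (h1 : g1.length = k)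
    (w : List Bool) {m r : ℕ} (hm : m < w.length) (hr : r < k) :
    (applyMorph g0 g1 w).getD (k * m + r) false =
      (bif w.getD m false then g1 else g0).getD r false := by
  induction w generalizing m with
  | nil => simp at hm
  | cons a w ih =>
    have hlen : (bif a then g1 else g0).length = k := by cases a <;> simp [h0, h1]
    have hcons : applyMorph g0 g1 (a :: w) = (bif a then g1 else g0) ++ applyMorph g0 g1 w := by
      simp [applyMorph]
    rw [hcons]
    cases m with
    | zero =>
      rw [List.getD_append _ _ _ _ (by rw [hlen]; omega)]
      simp
    | succ m =>
      rw [List.getD_append_right _ _ _ _ (by rw [hlen, mul_add]; omega), hlen,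
        show k * (m + 1) + r - k = k * m + r by rw [mul_add]; omega,
        ih (by simpa using hm), List.getD_cons_succ]

/-- The images `g0`, `g1` have a common prefix of length `A` and a common suffix of length `B`. -/
def SharedEnds (g0 g1 : List Bool) (k A B : ℕ) : Prop :=
  (A ≤ k ∧ B ≤ k) ∧ (∀ r < A, g0.getD r false = g1.getD r false) ∧
    ∀ r < k, k - B ≤ r → g0.getD r false = g1.getD r false

/-- The first and last letters of `w` enclose a factor of length `L` with period `p`. -/
def Encloses (w : List Bool) (L p : ℕ) : Prop :=
  w.length = L + 2 ∧ ∀ m, m + p < L → w.getD (m + 1) false = w.getD (m + 1 + p) false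

theorem le_ce_applyMorph {g0 g1 : List Bool} {k A B : ℕ} (hk : 0 < k)
    (h0 : g0.length = k) (h1 : g1.length = k) (hs : SharedEnds g0 g1 k A B)
    {w : List Bool} {L p : ℕ} (hp : 1 ≤ p) (hpL : p ≤ L) (hw : Encloses w L p) :
    ((B + k * L + A : ℕ) : ℝ) / ((k * p : ℕ) : ℝ) ≤ ce (applyMorph g0 g1 w) := by
  obtain ⟨⟨hA, hB⟩, hpre, hsuf⟩ := hs
  obtain ⟨hlen, hper⟩ := hw
  have hkp : k * p ≤ k * L := Nat.mul_le_mul_left _ hpL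
  refine le_ce (Nat.mul_pos hk hp) (by omega)
    ((hasRep_iff (by omega)).mpr ⟨k - B, ?_, fun j hj => ?_⟩)
  · rw [length_applyMorph_s18 h0 h1, hlen, mul_add]; omega
  have hbranch : ∀ (a b : Bool) (r : ℕ), g0.getD r false = g1.getD r false →
      (bif a then g1 else g0).getD r false = (bif b then g1 else g0).getD r false := by
    intro a b r h
    cases a <;> cases b <;> simp only [cond_true, cond_false, h]
  obtain ⟨m, r, hr, ht⟩ : ∃ m r, r < k ∧ k - B + j = k * m + r :=
    ⟨(k - B + j) / k, (k - B + j) % k, Nat.mod_lt _ hk, (Nat.div_add_mod _ _).symm⟩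
  have hmp : k * (m + p) + r < k * (L + 1) + A := by
    rw [mul_add, mul_add]; omega
  have hmL : m + p ≤ L + 1 := by
    have : k * (m + p) < k * (L + 2) := by
      rw [mul_add k L 2]; rw [mul_add k L 1] at hmp; omega
    have := Nat.lt_of_mul_lt_mul_left this
    omega
  rw [ht, show k * m + r + k * p = k * (m + p) + r by ring,
    getD_applyMorph_s18 h0 h1 _ (by omega) hr, getD_applyMorph_s18 h0 h1 _ (by omega) hr]
  rcases Nat.eq_zero_or_pos m with rfl | hm
  · exact hbranch _ _ _ (hsuf r hr (by omega))
  rcases hmL.eq_or_lt with hmL' | hmL'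
  · rw [hmL'] at hmp
    exact hbranch _ _ _ (hpre r (by omega))
  · obtain ⟨m, rfl⟩ : ∃ m', m = m' + 1 := ⟨m - 1, by omega⟩
    rw [hper m (by omega)]

end Morphism

section PeriodicWords

/-- The Thue–Morse morphism acting on infinite words. -/
def blockLift (f : ℕ → Bool) (m : ℕ) : Bool := xor (f (m / 2)) (m % 2 == 1)

theorem blockLift_even (f : ℕ → Bool) (m : ℕ) : blockLift f (2 * m) = f m := by
  simp [blockLift]

theorem blockLift_odd (f : ℕ → Bool) (m : ℕ) : blockLift f (2 * m + 1) = !f m := by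
  have : (2 * m + 1) / 2 = m := by omega
  simp [blockLift, this]

/-- No overlap in `f` has a period smaller than `p`. -/
def NoShortOverlap (f : ℕ → Bool) (p : ℕ) : Prop :=
  ∀ i q, 1 ≤ q → q < p → ¬ ∀ j ≤ q, f (i + j) = f (i + j + q)

theorem NoShortOverlap.blockLift {f : ℕ → Bool} {p : ℕ} (hf : NoShortOverlap f p) :
    NoShortOverlap (blockLift f) (2 * p) := by
  intro i q hq hqp H
  rcases Nat.even_or_odd' q with ⟨r, rfl | rfl⟩
  · refine hf (i / 2) r (by omega) (by omega) fun j hj => ?_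
    rcases Nat.even_or_odd' i with ⟨c, rfl | rfl⟩
    · have := H (2 * j) (by omega)
      rw [show 2 * c + 2 * j = 2 * (c + j) by ring,
        show 2 * (c + j) + 2 * r = 2 * (c + j + r) by ring, blockLift_even, blockLift_even] at this
      rwa [show 2 * c / 2 = c by omega]
    · have := H (2 * j) (by omega)
      rw [show 2 * c + 1 + 2 * j = 2 * (c + j) + 1 by ring,
        show 2 * (c + j) + 1 + 2 * r = 2 * (c + j + r) + 1 by ring, blockLift_odd,
        blockLift_odd] at this
      rw [show (2 * c + 1) / 2 = c by omega]
      simpa using this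
  · have hpair : ∀ m, m % 2 = 0 → _root_.blockLift f (m + 1) = !_root_.blockLift f m := by
      intro m hm
      obtain ⟨c, rfl⟩ : ∃ c, m = 2 * c := ⟨m / 2, by omega⟩
      rw [blockLift_odd, blockLift_even]
    have halt : ∀ j ≤ 2 * r, _root_.blockLift f (i + j + 1) = !_root_.blockLift f (i + j) := by
      intro j hj
      rcases Nat.mod_two_eq_zero_or_one (i + j) with h | h
      · exact hpair _ h
      · rw [H j (by omega), add_assoc i j 1, H (j + 1) (by omega),
          ← hpair _ (show (i + j + (2 * r + 1)) % 2 = 0 by omega)]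
        congr 1; ring
    have hodd : ∀ c ≤ r, _root_.blockLift f (i + (2 * c + 1)) = !_root_.blockLift f i := by
      intro c hc
      induction c with
      | zero => simpa using halt 0 (by omega)
      | succ c ih =>
        have h1 := halt (2 * c + 1) (by omega)
        have h2 := halt (2 * c + 2) (by omega)
        rw [show i + (2 * c + 1) + 1 = i + (2 * c + 2) by ring, ih (by omega)] at h1
        rw [show i + (2 * c + 2) + 1 = i + (2 * (c + 1) + 1) by ring, h1] at h2
        simpa using h2
    have := H 0 (by omega)
    rw [add_zero, hodd r le_rfl] at this
    simp at this

theorem blockLift_periodic {f : ℕ → Bool} {p : ℕ} (hf : ∀ m, f (m + p) = f m) (m : ℕ) :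
    blockLift f (m + 2 * p) = blockLift f m := by
  have h1 : (m + 2 * p) / 2 = m / 2 + p := by omega
  simp [blockLift, h1, hf]

/-- Replacing the letter of `f` at position `t + 2` by its complement creates neither a cube
of a letter to its left nor one to its right. -/
def FlipSafe (f : ℕ → Bool) (t : ℕ) : Prop :=
  (f t = f (t + 2) ∨ f (t + 1) = f (t + 2)) ∧ (f (t + 3) = f (t + 2) ∨ f (t + 4) = f (t + 2))

theorem flipSafe_blockLift_blockLift {f : ℕ → Bool} (h : f 0 ≠ f 1) :
    FlipSafe (blockLift (blockLift f)) 0 := by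
  revert h
  simp only [FlipSafe, blockLift]
  norm_num
  cases f 0 <;> cases f 1 <;> decide

/-- The factor of length `3 * p + 1` of `f` at position `t + 2`, with both end letters
complemented. -/
def flipEnds (f : ℕ → Bool) (p t : ℕ) : List Bool :=
  (List.range (3 * p + 1)).map fun m =>
    if m = 0 ∨ m = 3 * p then !f (t + 2 + m) else f (t + 2 + m)

theorem length_flipEnds (f : ℕ → Bool) (p t : ℕ) : (flipEnds f p t).length = 3 * p + 1 := by
  simp [flipEnds]

theorem getD_flipEnds (f : ℕ → Bool) (p t : ℕ) {m : ℕ} (hm : m < 3 * p + 1) :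
    (flipEnds f p t).getD m false =
      if m = 0 ∨ m = 3 * p then !f (t + 2 + m) else f (t + 2 + m) := by
  simp [flipEnds, List.getD_eq_getElem?_getD, List.getElem?_range hm]

theorem getD_flipEnds_interior (f : ℕ → Bool) {p t m : ℕ} (h0 : 0 < m) (hm : m < 3 * p) :
    (flipEnds f p t).getD m false = f (t + 2 + m) := by
  rw [getD_flipEnds _ _ _ (by omega), if_neg (by omega)]

theorem encloses_flipEnds {f : ℕ → Bool} {p t : ℕ} (hp : 2 ≤ p) (hf : ∀ m, f (m + p) = f m) :
    Encloses (flipEnds f p t) (3 * p - 1) p := by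
  refine ⟨by rw [length_flipEnds]; omega, fun m hmp => ?_⟩
  rw [getD_flipEnds_interior _ (by omega) (by omega),
    getD_flipEnds_interior _ (by omega) (by omega), ← add_assoc _ (m + 1) p, hf]

theorem not_cube_flipEnds {f : ℕ → Bool} {p t : ℕ} (hp : 2 ≤ p) (hf : ∀ m, f (m + p) = f m)
    (hov : NoShortOverlap f p) (hsafe : FlipSafe f t) {q : ℕ} (hq : 1 ≤ q) (hqp : q < p) :
    hasRep (flipEnds f p t) (3 * q) q = false := by
  rw [Bool.eq_false_iff, Ne, hasRep_iff (by omega)]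
  rintro ⟨i, hi, H⟩
  rw [length_flipEnds] at hi
  have hf3 : ∀ m, f (m + 3 * p) = f m := fun m => by
    rw [show m + 3 * p = m + p + p + p by ring, hf, hf, hf]
  rcases hq.eq_or_lt with rfl | hq2
  · have e0 := H 0 (by omega)
    have e1 := H 1 (by omega)
    simp only [add_zero] at e0
    by_cases hi0 : i = 0
    · subst hi0
      rw [getD_flipEnds _ _ _ (by omega), if_pos (Or.inl rfl),
        getD_flipEnds_interior _ (by omega) (by omega)] at e0
      rw [getD_flipEnds_interior _ (by omega) (by omega),
        getD_flipEnds_interior _ (by omega) (by omega)] at e1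
      have h := hsafe.2
      simp only [zero_add, add_zero] at e0 e1
      rw [show t + 2 + 1 = t + 3 by ring] at e0 e1
      rw [show t + 2 + (1 + 1) = t + 4 by ring] at e1
      rw [← e1, ← e0] at h
      simp at h
    by_cases hi3 : i = 3 * p - 2
    · subst hi3
      rw [getD_flipEnds_interior _ (by omega) (by omega),
        getD_flipEnds_interior _ (by omega) (by omega),
        show t + 2 + (3 * p - 2) = t + 3 * p by omega,
        show t + 2 + (3 * p - 2 + 1) = t + 1 + 3 * p by omega, hf3, hf3] at e0
      rw [getD_flipEnds_interior _ (by omega) (by omega), getD_flipEnds _ _ _ (by omega),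
        if_pos (Or.inr (by omega)), show t + 2 + (3 * p - 2 + 1) = t + 1 + 3 * p by omega,
        show t + 2 + (3 * p - 2 + 1 + 1) = t + 2 + 3 * p by omega, hf3, hf3] at e1
      have h := hsafe.1
      rw [e0, e1] at h
      simp at h
    · refine hov (t + 2 + i) 1 le_rfl hqp fun j hj => ?_
      have := H j (by omega)
      rwa [getD_flipEnds_interior _ (by omega) (by omega),
        getD_flipEnds_interior _ (by omega) (by omega), ← add_assoc, ← add_assoc,
        ← add_assoc] at this
  · obtain ⟨d, hd1, hd2⟩ : ∃ d ≤ 1, 1 ≤ i + d ∧ i + d ≤ 3 * p - 1 - 2 * q := by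
      by_cases hi0 : i = 0
      · exact ⟨1, le_rfl, by omega, by omega⟩
      · exact ⟨0, by omega, by omega, by omega⟩
    refine hov (t + 2 + i + d) q hq hqp fun j hj => ?_
    have := H (d + j) (by omega)
    rw [getD_flipEnds_interior _ (by omega) (by omega),
      getD_flipEnds_interior _ (by omega) (by omega)] at this
    rw [show t + 2 + i + d + j = t + 2 + (i + (d + j)) by ring, this, ← add_assoc _ _ q]

theorem ce_flipEnds_le {f : ℕ → Bool} {p t : ℕ} (hp : 2 ≤ p) (hf : ∀ m, f (m + p) = f m)
    (hov : NoShortOverlap f p) (hsafe : FlipSafe f t) :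
    ce (flipEnds f p t) ≤ ((3 * p - 1 : ℕ) : ℝ) / p := by
  refine ce_le (by positivity) fun ℓ q hq hqℓ hrep => ?_
  have hp' : (0 : ℝ) < p := by exact_mod_cast (by omega : 0 < p)
  rw [div_mul_eq_mul_div, le_div_iff₀ hp']
  suffices h : ℓ * p ≤ (3 * p - 1) * q by exact_mod_cast h
  by_contra! hlt
  obtain ⟨i, hi, H⟩ := (hasRep_iff hqℓ).mp hrep
  rw [length_flipEnds] at hi
  rcases lt_trichotomy q p with hqp | rfl | hqp
  · have h3 : 3 * q ≤ ℓ := by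
      by_contra! h
      have h1 : ℓ * p ≤ (3 * q - 1) * p := Nat.mul_le_mul_right _ (by omega)
      zify [show 1 ≤ 3 * p by omega, show 1 ≤ 3 * q by omega] at h1 hlt hqp
      nlinarith
    exact absurd (hasRep_anti (by omega) h3 hrep)
      (by simp [not_cube_flipEnds hp hf hov hsafe hq hqp])
  · have h3 : 3 * q ≤ ℓ := by
      have := Nat.lt_of_mul_lt_mul_right hlt
      omega
    rcases Nat.eq_zero_or_pos i with rfl | hi0
    · have := H 0 (by omega)
      rw [getD_flipEnds _ _ _ (by omega), if_pos (Or.inl rfl),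
        getD_flipEnds_interior _ (by omega) (by omega)] at this
      simp only [zero_add, add_zero, hf] at this
      simp at this
    · have := H (2 * q - 1) (by omega)
      rw [getD_flipEnds_interior _ (by omega) (by omega), getD_flipEnds _ _ _ (by omega),
        if_pos (Or.inr (by omega)), ← add_assoc _ _ q, hf] at this
      simp at this
  · have h1 : ℓ * p ≤ (3 * p + 1) * p := Nat.mul_le_mul_right _ (by omega)
    have h2 : (3 * p - 1) * (p + 1) ≤ (3 * p - 1) * q := Nat.mul_le_mul_left _ hqp
    zify [show 1 ≤ 3 * p by omega] at h1 h2 hlt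
    nlinarith

end PeriodicWords

/-- Some word of critical exponent at most `L / p` encloses a factor of length `L` and
period `p`. -/
def Extremal (L p : ℕ) : Prop :=
  ∃ w : List Bool, ce w ≤ (L : ℝ) / p ∧ Encloses w L p

/-- `f` has period `p` and no overlap of smaller period. -/
def OverlapFreePeriodic (f : ℕ → Bool) (p : ℕ) : Prop :=
  (∀ m, f (m + p) = f m) ∧ NoShortOverlap f p

theorem OverlapFreePeriodic.blockLift {f : ℕ → Bool} {p : ℕ} (h : OverlapFreePeriodic f p) :
    OverlapFreePeriodic (blockLift f) (2 * p) :=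
  ⟨blockLift_periodic h.1, h.2.blockLift⟩

theorem OverlapFreePeriodic.extremal {f : ℕ → Bool} {p t : ℕ} (h : OverlapFreePeriodic f p)
    (hp : 2 ≤ p) (hsafe : FlipSafe f t) : Extremal (3 * p - 1) p :=
  ⟨flipEnds f p t, ce_flipEnds_le hp h.1 h.2 hsafe, encloses_flipEnds hp h.1⟩

theorem OverlapFreePeriodic.extremal_pow {f : ℕ → Bool} {p : ℕ} (h : OverlapFreePeriodic f p)
    (hp : 1 ≤ p) (h01 : f 0 ≠ f 1) (n : ℕ) :
    Extremal (3 * (4 * p * 2 ^ n) - 1) (4 * p * 2 ^ n) := by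
  induction n generalizing f p with
  | zero =>
    have := h.blockLift.blockLift.extremal (by omega) (flipSafe_blockLift_blockLift h01)
    rwa [show 2 * (2 * p) = 4 * p * 2 ^ 0 by ring] at this
  | succ n ih =>
    have := ih h.blockLift (by omega) (by simp [_root_.blockLift])
    rwa [show 4 * (2 * p) * 2 ^ n = 4 * p * 2 ^ (n + 1) by ring] at this

theorem overlapFreePeriodic_two : OverlapFreePeriodic (fun m => m % 2 == 1) 2 := by
  refine ⟨fun m => by simp, fun i q h1 h2 H => ?_⟩
  obtain rfl : q = 1 := by omega
  have := H 0 (by omega)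
  rcases Nat.mod_two_eq_zero_or_one i with h | h <;> simp [Nat.add_mod, h] at this

theorem overlapFreePeriodic_three : OverlapFreePeriodic (fun m => m % 3 == 1) 3 := by
  refine ⟨fun m => by simp, fun i q h1 h2 H => ?_⟩
  have a0 := H 0 (by omega)
  have a1 := H 1 (by omega)
  obtain rfl | rfl : q = 1 ∨ q = 2 := by omega
  · rcases (by omega : i % 3 = 0 ∨ i % 3 = 1 ∨ i % 3 = 2) with h | h | h <;>
      simp [Nat.add_mod, h] at a0 a1
  · have a2 := H 2 (by omega)
    rcases (by omega : i % 3 = 0 ∨ i % 3 = 1 ∨ i % 3 = 2) with h | h | h <;>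
      simp [Nat.add_mod, h] at a0 a1 a2

theorem extremal_of_word (w : List Bool) (L p : ℕ) (hp : 0 < p) (hpL : p ≤ L)
    (hlen : w.length = L + 2) (hper : agreeAtStart (L - p) (w.drop 1) (w.drop (1 + p)) = true)
    (h : (List.range w.length).all
      (fun q => !hasRep w (L * (q + 1) / p + 1) (q + 1)) = true) : Extremal L p := by
  refine ⟨w, ce_le_of_hasRep_eq_false L p hp hpL h, hlen, fun m hm => ?_⟩
  have := (agreeAtStart_iff.mp hper).2.2 m (by omega)
  simpa [List.getD_eq_getElem?_getD, List.getElem?_drop, add_comm, add_left_comm] using this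

theorem extremal_five_two : Extremal 5 2 :=
  overlapFreePeriodic_two.extremal (t := 0) le_rfl (by unfold FlipSafe; decide)

theorem extremal_eight_three : Extremal 8 3 :=
  extremal_of_word [true, false, true, false, false, true, false, false, true, true] _ _
    (by norm_num) (by norm_num) rfl (by decide +kernel) (by decide +kernel)

theorem extremal_twentyFive_nine : Extremal 25 9 :=
  extremal_of_word
    [true, false, true, false, false, true, false, true, true, false, false, true, false,
    false, true, false, true, true, false, false, true, false, false, true, false, true,
    false]
    _ _ (by norm_num) (by norm_num) rfl (by decide +kernel) (by decide +kernel)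

theorem extremal_fourteen_five : Extremal 14 5 :=
  extremal_of_word
    [false, false, true, true, false, true, false, true, true, false, true, false, true, true,
    false, false]
    _ _ (by norm_num) (by norm_num) rfl (by decide +kernel) (by decide +kernel)

theorem extremal_seventeen_six : Extremal 17 6 :=
  extremal_of_word
    [false, false, true, false, false, true, true, false, true, false, false, true, true,
    false, true, false, false, true, false]
    _ _ (by norm_num) (by norm_num) rfl (by decide +kernel) (by decide +kernel)

/-- The images under `0 ↦ g0, 1 ↦ g1` witness, for each exponent between `a` and `b`, that the
morphism does not preserve upper bounds on critical exponents, whether strict or not. -/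
def Breaks (g0 g1 : List Bool) (a b : ℝ) : Prop :=
  (∀ α, a < α → α ≤ b → ∃ w, ce w < α ∧ α ≤ ce (applyMorph g0 g1 w)) ∧
    ∀ α, a ≤ α → α < b → ∃ w, ce w ≤ α ∧ α < ce (applyMorph g0 g1 w)

section Breaks

variable {g0 g1 : List Bool} {a b c d : ℝ}

theorem Breaks.of_word (w : List Bool) (h1 : ce w ≤ a) (h2 : b ≤ ce (applyMorph g0 g1 w)) :
    Breaks g0 g1 a b :=
  ⟨fun _ ha hb => ⟨w, h1.trans_lt ha, hb.trans h2⟩,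
    fun _ ha hb => ⟨w, h1.trans ha, hb.trans_le h2⟩⟩

theorem Breaks.trans (h : Breaks g0 g1 a b) (h' : Breaks g0 g1 c d) (hcb : c ≤ b) :
    Breaks g0 g1 a d := by
  refine ⟨fun α ha hd => ?_, fun α ha hd => ?_⟩
  · rcases le_or_gt α b with hb | hb
    · exact h.1 α ha hb
    · exact h'.1 α (hcb.trans_lt hb) hd
  · rcases lt_or_ge α b with hb | hb
    · exact h.2 α ha hb
    · exact h'.2 α (hcb.trans hb) hd

theorem Breaks.mono (h : Breaks g0 g1 a b) (hca : a ≤ c) (hdb : d ≤ b) : Breaks g0 g1 c d :=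
  ⟨fun α ha hb => h.1 α (hca.trans_lt ha) (hb.trans hdb),
    fun α ha hb => h.2 α (hca.trans ha) (hb.trans_le hdb)⟩

theorem Extremal.breaks {k A B e L p : ℕ} (hk : 0 < k) (h0 : g0.length = k) (h1 : g1.length = k)
    (hs : SharedEnds g0 g1 k A B) (hAB : k ≤ e * (A + B)) (hp : 1 ≤ p) (hpL : p ≤ L)
    (h : Extremal L p) : Breaks g0 g1 (L / p) ((e * L + 1) / (e * p)) := by
  obtain ⟨w, hw, henc⟩ := h
  refine .of_word w hw (le_trans ?_ (le_ce_applyMorph hk h0 h1 hs hp hpL henc))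
  have he : 0 < e := Nat.pos_of_ne_zero fun h => by subst h; omega
  have hk' : (0 : ℝ) < k := by exact_mod_cast hk
  have he' : (0 : ℝ) < e := by exact_mod_cast he
  have hp' : (0 : ℝ) < p := by exact_mod_cast hp
  have hAB' : (k : ℝ) ≤ e * (A + B) := by exact_mod_cast hAB
  push_cast
  rw [div_le_div_iff₀ (by positivity) (by positivity)]
  nlinarith [mul_le_mul_of_nonneg_left hAB' hp'.le]

variable {k A B : ℕ}

theorem breaks_of_three_mul_sub_one (hk : 0 < k) (h0 : g0.length = k) (h1 : g1.length = k)
    (hs : SharedEnds g0 g1 k A B) (hAB : k ≤ 3 * (A + B)) {p : ℕ} (hp : 1 ≤ p)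
    (h : Extremal (3 * p - 1) p) :
    Breaks g0 g1 (3 - 1 / (p : ℝ)) (3 - 2 / (3 * (p : ℝ))) := by
  have hp' : (0 : ℝ) < p := by exact_mod_cast hp
  refine (h.breaks hk h0 h1 hs hAB hp (by omega)).mono (le_of_eq ?_) (le_of_eq ?_) <;>
  · push_cast [Nat.cast_sub (show 1 ≤ 3 * p by omega)]
    field_simp
    try ring

theorem breaks_eight_thirds (hk : 0 < k) (h0 : g0.length = k) (h1 : g1.length = k)
    (hs : SharedEnds g0 g1 k A B) (hAB : k ≤ 3 * (A + B)) (n : ℕ) :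
    Breaks g0 g1 (8 / 3) (3 - 1 / (12 * 2 ^ n)) := by
  induction n with
  | zero =>
    have e1 := extremal_eight_three.breaks hk h0 h1 hs hAB (by norm_num) (by norm_num)
    have e2 := extremal_twentyFive_nine.breaks hk h0 h1 hs hAB (by norm_num) (by norm_num)
    have e3 := extremal_fourteen_five.breaks hk h0 h1 hs hAB (by norm_num) (by norm_num)
    have e4 := extremal_seventeen_six.breaks hk h0 h1 hs hAB (by norm_num) (by norm_num)
    have e5 := (overlapFreePeriodic_two.extremal_pow (by norm_num) (by decide) 0).breaks
      hk h0 h1 hs hAB (by norm_num) (by norm_num)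
    norm_num at e1 e2 e3 e4 e5 ⊢
    exact (((e1.trans e2 (by norm_num)).trans e3 (by norm_num)).trans e4 (by norm_num)).trans e5
      (by norm_num)
  | succ n ih =>
    have e1 := breaks_of_three_mul_sub_one hk h0 h1 hs hAB
      (Nat.mul_pos (by norm_num) (by positivity))
      (overlapFreePeriodic_three.extremal_pow (by norm_num) (by decide) n)
    have e2 := breaks_of_three_mul_sub_one hk h0 h1 hs hAB
      (Nat.mul_pos (by norm_num) (by positivity))
      (overlapFreePeriodic_two.extremal_pow (by norm_num) (by decide) (n + 1))
    have hpow : (0 : ℝ) < 2 ^ n := by positivity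
    push_cast at e1 e2
    refine ((ih.trans e1 (le_of_eq ?_)).trans e2 ?_).mono le_rfl (le_of_eq ?_)
    · norm_num
    · rw [pow_succ]
      have : (2 : ℝ) / (3 * (4 * 3 * 2 ^ n)) ≤ 1 / (4 * 2 * (2 ^ n * 2)) := by
        rw [div_le_div_iff₀ (by positivity) (by positivity)]
        nlinarith
      linarith
    · rw [pow_succ]
      field_simp
      ring

theorem breaks_eight_thirds_of_lt_three (hk : 0 < k) (h0 : g0.length = k) (h1 : g1.length = k)
    (hs : SharedEnds g0 g1 k A B) (hAB : k ≤ 3 * (A + B)) (hb : b < 3) :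
    Breaks g0 g1 (8 / 3) b := by
  obtain ⟨n, hn⟩ := pow_unbounded_of_one_lt (1 / (3 - b)) (one_lt_two : (1 : ℝ) < 2)
  refine (breaks_eight_thirds hk h0 h1 hs hAB n).mono le_rfl ?_
  have hb' : 0 < 3 - b := by linarith
  have hpow : (0 : ℝ) < 2 ^ n := by positivity
  rw [div_lt_iff₀ hb'] at hn
  have : 1 / (12 * 2 ^ n) ≤ 3 - b := by
    rw [div_le_iff₀ (by positivity)]
    nlinarith
  linarith

end Breaks

section Classification

/-- A collection of words of critical exponent at most 2. -/
def overlapFreeWords : List (List Bool) :=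
  [[false], [true], [false, true], [true, false], [false, false, true], [false, true, true],
    [true, false, false], [false, true, true, false]]

theorem ce_le_two_of_mem {w : List Bool} (hw : w ∈ overlapFreeWords) : ce w ≤ 2 := by
  have h : (overlapFreeWords.all fun w => (List.range w.length).all
      fun q => !hasRep w (2 * (q + 1) / 1 + 1) (q + 1)) = true := by decide +kernel
  simpa using ce_le_of_hasRep_eq_false 2 1 one_pos one_le_two (List.all_eq_true.mp h w hw)

/-- One of the pairs `(ℓ, q)` in `l` is the length and a period of a factor of the image of some
word in `overlapFreeWords`. -/
def imageHasRep (g0 g1 : List Bool) (l : List (ℕ × ℕ)) : Bool :=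
  l.any fun c => overlapFreeWords.any fun w => hasRep (applyMorph g0 g1 w) c.1 c.2

/-- The total length of the shared ends of `g0` and `g1` is at least `k / e`. -/
def sharesAtLeast (g0 g1 : List Bool) (k e : ℕ) : Bool :=
  (List.range k).any fun A => (List.range k).any fun B =>
    decide (k ≤ e * (A + B)) && agreeAtStart A g0 g1 &&
      agreeAtStart B (g0.drop (k - B)) (g1.drop (k - B))

theorem exists_sharedEnds {g0 g1 : List Bool} {k e : ℕ} (h : sharesAtLeast g0 g1 k e = true) :
    ∃ A B, k ≤ e * (A + B) ∧ SharedEnds g0 g1 k A B := by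
  simp only [sharesAtLeast, List.any_eq_true, List.mem_range, Bool.and_eq_true,
    decide_eq_true_eq, agreeAtStart_iff] at h
  obtain ⟨A, hA, B, hB, ⟨hAB, -, -, hpre⟩, -, -, hsuf⟩ := h
  refine ⟨A, B, hAB, ⟨hA.le, hB.le⟩, hpre, fun r hr hrB => ?_⟩
  have := hsuf (r - (k - B)) (by omega)
  simpa [List.getD_eq_getElem?_getD, List.getElem?_drop, Nat.add_sub_cancel' hrB] using this

/-- The alternatives that hold for 3-uniform and 6-uniform binary morphisms. -/
def classification (k : ℕ) (g0 g1 : List Bool) : Bool :=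
  (hasRep (applyMorph g0 g1 [false, true]) 2 1 || hasRep (applyMorph g0 g1 [false, true]) 4 2) &&
    (imageHasRep g0 g1 [(3, 1), (6, 2), (9, 3), (12, 4), (18, 6)] ||
      (sharesAtLeast g0 g1 k 3 && imageHasRep g0 g1 [(8, 3), (16, 6)]) ||
      (sharesAtLeast g0 g1 k 2 && imageHasRep g0 g1 [(5, 2)]))

/-- All binary words of length `k`. -/
def wordsOfLength : ℕ → List (List Bool)
  | 0 => [[]]
  | k + 1 => (wordsOfLength k).flatMap fun w => [false :: w, true :: w]

theorem mem_wordsOfLength {w : List Bool} {k : ℕ} (hw : w.length = k) : w ∈ wordsOfLength k := by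
  subst hw
  induction w with
  | nil => simp [wordsOfLength]
  | cons a w ih =>
    simp only [List.length_cons, wordsOfLength, List.mem_flatMap]
    exact ⟨w, ih, by cases a <;> simp⟩

theorem classification_eq_true {k : ℕ} (hk : k = 3 ∨ k = 6) {g0 g1 : List Bool}
    (h0 : g0.length = k) (h1 : g1.length = k) : classification k g0 g1 = true := by
  have hall : ((wordsOfLength k).all fun g0 =>
      (wordsOfLength k).all fun g1 => classification k g0 g1) = true := by
    rcases hk with rfl | rfl <;> decide +kernel
  exact List.all_eq_true.mp (List.all_eq_true.mp hall g0 (mem_wordsOfLength h0)) g1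
    (mem_wordsOfLength h1)

theorem breaks_of_imageHasRep {g0 g1 : List Bool} {l : List (ℕ × ℕ)} {b : ℝ}
    (hl : ∀ c ∈ l, 1 ≤ c.2 ∧ c.2 ≤ c.1 ∧ b ≤ (c.1 : ℝ) / c.2)
    (h : imageHasRep g0 g1 l = true) : Breaks g0 g1 2 b := by
  simp only [imageHasRep, List.any_eq_true] at h
  obtain ⟨c, hc, w, hw, hrep⟩ := h
  obtain ⟨hc1, hc2, hb⟩ := hl c hc
  exact .of_word w (ce_le_two_of_mem hw) (hb.trans (le_ce hc1 hc2 hrep))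

theorem breaks_one_two {k : ℕ} (hk : k = 3 ∨ k = 6) {g0 g1 : List Bool}
    (h0 : g0.length = k) (h1 : g1.length = k) : Breaks g0 g1 1 2 := by
  have h := classification_eq_true hk h0 h1
  simp only [classification, Bool.and_eq_true, Bool.or_eq_true] at h
  refine .of_word [false, true] ?_ ?_
  · simpa using ce_le_of_hasRep_eq_false (u := [false, true]) 1 1 one_pos le_rfl (by decide)
  · rcases h.1 with h | h
    · simpa using le_ce le_rfl one_le_two h
    · have := le_ce one_le_two (by norm_num) h
      norm_num at this
      exact this

theorem breaks_two {k : ℕ} (hk : k = 3 ∨ k = 6) {g0 g1 : List Bool}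
    (h0 : g0.length = k) (h1 : g1.length = k) {b : ℝ} (hb : b < 3) : Breaks g0 g1 2 b := by
  have h := classification_eq_true hk h0 h1
  have hk0 : 0 < k := by omega
  simp only [classification, Bool.and_eq_true, Bool.or_eq_true] at h
  rcases h.2 with (h | ⟨hs, h⟩) | ⟨hs, h⟩
  · exact (breaks_of_imageHasRep (b := 3) (by simp; norm_num) h).mono le_rfl hb.le
  · obtain ⟨A, B, hAB, hs⟩ := exists_sharedEnds hs
    exact (breaks_of_imageHasRep (b := 8 / 3) (by simp; norm_num) h).trans
      (breaks_eight_thirds_of_lt_three hk0 h0 h1 hs hAB hb) le_rfl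
  · obtain ⟨A, B, hAB, hs⟩ := exists_sharedEnds hs
    have e := extremal_five_two.breaks hk0 h0 h1 hs hAB (by norm_num) (by norm_num)
    norm_num at e
    exact ((breaks_of_imageHasRep (b := 5 / 2) (by simp) h).trans e le_rfl).trans
      (breaks_eight_thirds_of_lt_three hk0 h0 h1 hs (by omega) hb) (by norm_num)

end Classification

/-- for every real `1 < α < 3`, no 3-uniform or 6-uniform binary
morphism is `α`-free, and none is `α⁺`-free. -/
theorem stmt18 (α : ℝ) (hα1 : 1 < α) (hα3 : α < 3)
    (g0 g1 : List Bool) (k : ℕ) (hk : k = 3 ∨ k = 6)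
    (hl0 : g0.length = k) (hl1 : g1.length = k) :
    (∃ w : List Bool, ce w < α ∧ α ≤ ce (applyMorph g0 g1 w)) ∧
    (∃ w' : List Bool, ce w' ≤ α ∧ α < ce (applyMorph g0 g1 w')) := by
  obtain ⟨b, hαb, hb⟩ := exists_between hα3
  have h := (breaks_one_two hk hl0 hl1).trans (breaks_two hk hl0 hl1 hb) le_rfl
  exact ⟨h.1 α hα1 hαb.le, h.2 α hα1.le hαb⟩
end

section
/- Let v be a finite factor of the Thue–Morse word t of length k such that either (a) v has 0110 or 1001 as a prefix and 0010 or 1101 as a suffix, or (b) v has 0100 or 1011 as a prefix and 0110 or 1001 as a suffix. Then the clipped Thue–Morse morphism f_v is (3 − 1/k)^+-free: for every finite binary word w with ce(w) ≤ 3 − 1/k, one has ce(f_v(w)) ≤ 3 − 1/k. -/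
theorem tm_ne_succ_of_even {n : ℕ} (h : n % 2 = 0) : tm n ≠ tm (n + 1) := by
  obtain ⟨m, rfl⟩ : ∃ m, n = 2 * m := ⟨n / 2, by omega⟩
  rw [tm_two_mul, tm_two_mul_add_one]
  cases tm m <;> simp

/-- Among four consecutive positions there is one where `tm` repeats a letter. -/
theorem exists_tm_eq_succ (a : ℕ) : ∃ i < 4, tm (a + i) = tm (a + i + 1) := by
  by_contra! h
  obtain ⟨c, m, hc, hm⟩ : ∃ c m, c < 2 ∧ a + c = 2 * m + 1 :=
    ⟨(a + 1) % 2, (a + (a + 1) % 2 - 1) / 2, by omega, by omega⟩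
  have step : ∀ j, tm (2 * j + 1) ≠ tm (2 * j + 1 + 1) → tm j = tm (j + 1) := by
    intro j hj
    rw [tm_two_mul_add_one, show 2 * j + 1 + 1 = 2 * (j + 1) by ring, tm_two_mul] at hj
    revert hj
    cases tm j <;> cases tm (j + 1) <;> simp
  have h1 := step m (by rw [← hm]; exact h c (by omega))
  have h2 := step (m + 1) (by
    have := h (c + 2) (by omega)
    rwa [show a + (c + 2) = 2 * (m + 1) + 1 by omega] at this)
  rcases Nat.mod_two_eq_zero_or_one m with hp | hp
  · exact tm_ne_succ_of_even hp h1
  · exact tm_ne_succ_of_even (n := m + 1) (by omega) h2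

/-- The Thue–Morse word is overlap-free. -/
theorem tm_overlap_free (p : ℕ) (hp : 1 ≤ p) (a : ℕ) :
    ∃ i ≤ p, tm (a + i) ≠ tm (a + i + p) := by
  induction p using Nat.strong_induction_on generalizing a with
  | _ p ih =>
    by_contra! h
    rcases Nat.mod_two_eq_zero_or_one p with hpar | hpar
    · obtain ⟨q, rfl⟩ : ∃ q, p = 2 * q := ⟨p / 2, by omega⟩
      obtain ⟨i, hi, hne⟩ := ih q (by omega) (by omega) (a / 2)
      apply hne
      have := h (2 * i) (by omega)
      rcases Nat.mod_two_eq_zero_or_one a with ha | ha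
      · rwa [show a + 2 * i = 2 * (a / 2 + i) by omega,
          show 2 * (a / 2 + i) + 2 * q = 2 * (a / 2 + i + q) by ring, tm_two_mul, tm_two_mul] at this
      · rw [show a + 2 * i = 2 * (a / 2 + i) + 1 by omega,
          show 2 * (a / 2 + i) + 1 + 2 * q = 2 * (a / 2 + i + q) + 1 by ring,
          tm_two_mul_add_one, tm_two_mul_add_one] at this
        simpa using this
    · have key : ∀ i < p, tm (a + i) ≠ tm (a + i + 1) ∧ tm (a + i + p) ≠ tm (a + i + p + 1) := by
        intro i hi
        have h1 := h i (by omega)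
        have h2 := h (i + 1) (by omega)
        rw [show a + (i + 1) = a + i + 1 by ring, show a + i + 1 + p = a + i + p + 1 by ring] at h2
        rcases Nat.mod_two_eq_zero_or_one (a + i) with ha | ha
        · have := tm_ne_succ_of_even ha
          exact ⟨this, by rwa [← h1, ← h2]⟩
        · have := tm_ne_succ_of_even (n := a + i + p) (by omega)
          exact ⟨by rwa [h1, h2], this⟩
      by_cases hp1 : p = 1
      · subst hp1
        exact (key 0 (by omega)).1 (h 0 (by omega))
      · obtain ⟨i, hi, he⟩ := exists_tm_eq_succ a
        rcases lt_or_ge i p with hip | hip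
        · exact (key i hip).1 he
        · have := (key (i - p) (by omega)).2
          rw [show a + (i - p) + p = a + i by omega] at this
          exact this he

/-- The position `C` of `s` starts a block of length `k` that looks like a suitably clipped
factor of the Thue–Morse word. -/
structure IsBlock (k : ℕ) (s : ℕ → Bool) (C : ℕ) : Prop where
  parity : ∀ j, j % 2 = 0 → j + 1 < k → s (C + j) ≠ s (C + j + 1)
  head : s (C + 1) = s (C + 2)
  tail : s (C + (k - 4)) = s (C + (k - 3))
  last : s (C + (k - 2)) ≠ s (C + (k - 1))
  overlap_free : ∀ a q, 1 ≤ q → a + 2 * q < k → ∃ i ≤ q, s (C + a + i) ≠ s (C + a + i + q)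

/-- The window of `s` of length `n` starting at `a` has period `p`. -/
def PeriodicOn (s : ℕ → Bool) (a n p : ℕ) : Prop :=
  ∀ i, a ≤ i → i + p < a + n → s i = s (i + p)

/-- `s` repeats a letter at position `i`. -/
def Repeats (s : ℕ → Bool) (i : ℕ) : Prop := s i = s (i + 1)

theorem PeriodicOn.repeats_iff {s : ℕ → Bool} {a n p i j : ℕ} (h : PeriodicOn s a n p)
    (hi : a ≤ i) (hj : j = i + p) (hin : j + 1 < a + n) : Repeats s i ↔ Repeats s j := by
  subst hj
  unfold Repeats
  rw [h i hi (by omega), h (i + 1) (by omega) (by omega), show i + 1 + p = i + p + 1 by ring]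

namespace IsBlock

variable {k : ℕ} {s : ℕ → Bool} {C : ℕ}

theorem not_repeats (h : IsBlock k s C) {i : ℕ} (hi : C ≤ i) (hik : i + 1 < C + k)
    (hpar : (i - C) % 2 = 0) : ¬ Repeats s i := by
  have := h.parity (i - C) hpar (by omega)
  rwa [show C + (i - C) = i by omega] at this

theorem repeats_head (h : IsBlock k s C) {i : ℕ} (hi : i = C + 1) : Repeats s i := by
  subst hi; exact h.head

theorem repeats_tail (h : IsBlock k s C) (hk : 5 ≤ k) {i : ℕ} (hi : i + 4 = C + k) :
    Repeats s i := by
  have := h.tail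
  rwa [show C + (k - 4) = i by omega, show C + (k - 3) = i + 1 by omega] at this

theorem not_repeats_last (h : IsBlock k s C) (hk : 5 ≤ k) {i : ℕ} (hi : i + 2 = C + k) :
    ¬ Repeats s i := by
  have := h.last
  rwa [show C + (k - 2) = i by omega, show C + (k - 1) = i + 1 by omega] at this

theorem false_of_overlap (h : IsBlock k s C) {a n p b : ℕ} (hper : PeriodicOn s a n p)
    (hp : 1 ≤ p) (hab : a ≤ b) (hC : C ≤ b) (hn : b + 2 * p < a + n) (hk : b + 2 * p < C + k) :
    False := by
  obtain ⟨i, hi, hne⟩ := h.overlap_free (b - C) p hp (by omega)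
  apply hne
  rw [show C + (b - C) + i = b + i by omega]
  exact hper _ (by omega) (by omega)

/-- A block can occur in the concatenation of two blocks only at the two obvious positions. -/
theorem occurrence_eq_zero {D d : ℕ} (hk : 5 ≤ k) (hodd : k % 2 = 1)
    (hC : IsBlock k s C) (hD : IsBlock k s D) (hD' : d ≠ 0 → IsBlock k s (D + k)) (hd : d < k)
    (hocc : ∀ j < k, s (C + j) = s (D + d + j)) : d = 0 := by
  by_contra hd0
  have hD' := hD' hd0
  have occ : ∀ i j, C ≤ i → i + 1 < C + k → j + C = D + d + i →
      (Repeats s i ↔ Repeats s j) := by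
    intro i j h1 h2 h3
    have e1 := hocc (i - C) (by omega)
    have e2 := hocc (i - C + 1) (by omega)
    rw [show C + (i - C) = i by omega, show D + d + (i - C) = j by omega] at e1
    rw [show C + (i - C + 1) = i + 1 by omega, show D + d + (i - C + 1) = j + 1 by omega] at e2
    unfold Repeats
    rw [e1, e2]
  rcases Nat.mod_two_eq_zero_or_one d with hpar | hpar
  · by_cases h2 : d = 2
    · exact hD.not_repeats_last hk (i := D + k - 2) (by omega)
        ((occ (C + k - 4) _ (by omega) (by omega) (by omega)).1
          (hC.repeats_tail hk (by omega)))
    · exact hC.not_repeats (i := C + (k + 1 - d)) (by omega) (by omega) (by omega)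
        ((occ _ (D + k + 1) (by omega) (by omega) (by omega)).2 (hD'.repeats_head rfl))
  · by_cases h2 : d = k - 2
    · exact hC.not_repeats_last hk (i := C + k - 2) (by omega)
        ((occ _ (D + k + k - 4) (by omega) (by omega) (by omega)).2
          (hD'.repeats_tail hk (by omega)))
    · exact hD.not_repeats (i := D + d + 1) (by omega) (by omega) (by omega)
        ((occ (C + 1) _ (by omega) (by omega) (by omega)).1 (hC.repeats_head rfl))

/-- A cube of even period crossing the boundary `C` of two blocks barely crosses it. -/
theorem cube_boundary_of_even {a p : ℕ} (hk : 5 ≤ k) (hodd : k % 2 = 1)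
    (hC : IsBlock k s C) (hD : IsBlock k s (C + k)) (hpk : p < k) (hp : 2 ≤ p)
    (hpar : p % 2 = 0) (hper : PeriodicOn s a (3 * p) p) :
    a + 3 * p ≤ C + k + 2 ∨ C + k ≤ a + 3 := by
  by_contra! hcon
  have hp2 : p ≠ 2 := by
    rintro rfl
    have h1 := (hper.repeats_iff (i := C + k - 1) (j := C + k + 1) (by omega) (by omega)
      (by omega)).2 (hD.repeats_head rfl)
    exact hC.not_repeats (i := C + k - 3) (by omega) (by omega) (by omega)
      ((hper.repeats_iff (by omega) (by omega) (by omega)).2 h1)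
  have h1 : C + k + 1 < a + p := by
    by_contra! h
    exact hC.not_repeats (i := C + k + 1 - p) (by omega) (by omega) (by omega)
      ((hper.repeats_iff (j := C + k + 1) (by omega) (by omega) (by omega)).2 (hD.repeats_head rfl))
  by_cases h2 : C + k - 4 + p + 1 < a + 3 * p
  · exact hD.not_repeats (i := C + k - 4 + p) (by omega) (by omega) (by omega)
      ((hper.repeats_iff (i := C + k - 4) (by omega) (by omega) (by omega)).1
        (hC.repeats_tail hk (by omega)))
  · omega

/-- A sequence built from blocks contains no cube of even period less than `k`. -/
theorem no_even_cube {r p : ℕ} (hk : 5 ≤ k) (hodd : k % 2 = 1) (hr : r < k) (hp : 1 ≤ p)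
    (hpk : p < k) (hpar : p % 2 = 0) (hper : PeriodicOn s r (3 * p) p)
    (h0 : IsBlock k s 0) (h1 : k < r + 3 * p → IsBlock k s k)
    (h2 : 2 * k < r + 3 * p → IsBlock k s (2 * k)) : False := by
  have c1 : k < r + 3 * p → r + 3 * p ≤ k + 2 ∨ k ≤ r + 3 := fun h => by
    have := cube_boundary_of_even hk hodd h0 (by simpa using h1 h) hpk (by omega) hpar hper
    omega
  have c2 : 2 * k < r + 3 * p → r + 3 * p ≤ 2 * k + 2 ∨ 2 * k ≤ r + 3 := fun h => by
    have := cube_boundary_of_even hk hodd (h1 (by omega)) (by rw [← two_mul]; exact h2 h)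
      hpk (by omega) hpar hper
    omega
  by_cases e1 : k < r + 3 * p
  · replace h1 := h1 e1
    rcases c1 e1 with c | c
    · by_cases hp2 : p = 2
      · subst hp2
        exact h0.not_repeats_last hk (i := k - 2) (by omega)
          ((hper.repeats_iff (i := k - 4) (by omega) (by omega) (by omega)).1
            (h0.repeats_tail hk (by omega)))
      exact h0.false_of_overlap hper hp (le_refl r) (by omega) (by omega) (by omega)
    · by_cases e2 : 2 * k < r + 3 * p
      · replace h2 := h2 e2
        rcases c2 e2 with c' | c'
        · by_cases h2p : 2 * p < k
          · exact h1.false_of_overlap hper hp (b := k) (by omega) (by omega) (by omega) (by omega)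
          · exact h1.not_repeats_last hk (i := k + 1 + p) (by omega)
              ((hper.repeats_iff (by omega) rfl (by omega)).1 (h1.repeats_head rfl))
        · omega
      · by_cases hp2 : p = 2
        · subst hp2
          have e := hper k (by omega) (by omega)
          exact h1.not_repeats (i := k) (by omega) (by omega) (by omega)
            (e.trans (h1.repeats_head rfl).symm)
        exact h1.false_of_overlap hper hp (b := k) (by omega) (by omega) (by omega) (by omega)
  · exact h0.false_of_overlap hper hp (le_refl r) (by omega) (by omega) (by omega)

/-- A sequence built from blocks contains no cube of odd period less than `k`. -/
theorem no_odd_cube {r p : ℕ} (hk : 5 ≤ k) (hodd : k % 2 = 1) (hr : r < k) (hp : 1 ≤ p)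
    (hpk : p < k) (hpar : p % 2 = 1) (hper : PeriodicOn s r (3 * p) p)
    (h0 : IsBlock k s 0) (h1 : k < r + 3 * p → IsBlock k s k)
    (h2 : 2 * k < r + 3 * p → IsBlock k s (2 * k)) : False := by
  by_cases hp1 : p = 1
  · subst hp1
    have e1 : Repeats s r := hper r (by omega) (by omega)
    have e2 : Repeats s (r + 1) := hper (r + 1) (by omega) (by omega)
    rcases Nat.mod_two_eq_zero_or_one r with hr2 | hr2
    · by_cases hrk : r + 1 = k
      · exact (h1 (by omega)).not_repeats (by omega) (by omega) (by omega) e2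
      · exact h0.not_repeats (by omega) (by omega) (by omega) e1
    · by_cases hrk : r + 2 = k
      · exact h0.not_repeats_last hk (by omega) e1
      · exact h0.not_repeats (by omega) (by omega) (by omega) e2
  by_cases e1 : k < r + 3 * p
  swap
  · exact h0.false_of_overlap hper hp (le_refl r) (by omega) (by omega) (by omega)
  replace h1 := h1 e1
  by_cases e2 : 2 * k < r + 3 * p
  · have h2 := h2 e2
    by_cases hpk2 : p = k - 2
    · by_cases hrk : r ≤ k - 2
      · exact h0.not_repeats_last hk (i := k - 2) (by omega)
          ((hper.repeats_iff (j := 2 * k - 4) (by omega) (by omega) (by omega)).2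
            (h1.repeats_tail hk (by omega)))
      · by_cases hk5 : k = 5
        · exact h1.not_repeats_last hk (i := k + 3) (by omega)
            ((hper.repeats_iff (j := 2 * k + 1) (by omega) (by omega) (by omega)).2
              (h2.repeats_head rfl))
        · exact h2.not_repeats (i := 3 * k - 3) (by omega) (by omega) (by omega)
            ((hper.repeats_iff (i := 2 * k - 1) (by omega) (by omega) (by omega)).1
              ((hper.repeats_iff (i := k + 1) (by omega) (by omega) (by omega)).1
                (h1.repeats_head rfl)))
    · exact h1.not_repeats (i := k + 1 + p) (by omega) (by omega) (by omega)
        ((hper.repeats_iff (by omega) rfl (by omega)).1 (h1.repeats_head rfl))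
  · have hL : k < r + p + 4 := by
      by_contra! h
      exact h0.not_repeats (i := k - 4 - p) (by omega) (by omega) (by omega)
        ((hper.repeats_iff (j := k - 4) (by omega) (by omega) (by omega)).2
          (h0.repeats_tail hk (by omega)))
    have hR : r + 3 * p < k + p + 3 := by
      by_contra! h
      exact h1.not_repeats (i := k + 1 + p) (by omega) (by omega) (by omega)
        ((hper.repeats_iff (by omega) rfl (by omega)).1 (h1.repeats_head rfl))
    obtain rfl | rfl : p = 3 ∨ p = 5 := by omega
    · exact h0.not_repeats_last hk (i := k - 2) (by omega)
        ((hper.repeats_iff (j := k + 1) (by omega) (by omega) (by omega)).2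
          (h1.repeats_head rfl))
    · obtain rfl : k = r + 8 := by omega
      have n0 : ¬ Repeats s r := fun h => h0.not_repeats (i := r + 5) (by omega) (by omega)
        (by omega) ((hper.repeats_iff (by omega) rfl (by omega)).1 h)
      have n1 : ¬ Repeats s (r + 1) := h0.not_repeats (by omega) (by omega) (by omega)
      have n2 : ¬ Repeats s (r + 2) := fun h =>
        h1.not_repeats (i := r + 12) (by omega) (by omega) (by omega)
          ((hper.repeats_iff (i := r + 7) (by omega) rfl (by omega)).1
            ((hper.repeats_iff (by omega) rfl (by omega)).1 h))
      have n3 : ¬ Repeats s (r + 3) := h0.not_repeats (by omega) (by omega) (by omega)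
      have alt : ∀ i, ¬ Repeats s i → ¬ Repeats s (i + 1) → s i = s (i + 2) := by
        intro i
        unfold Repeats
        rw [show i + 1 + 1 = i + 2 by ring]
        cases s i <;> cases s (i + 1) <;> cases s (i + 2) <;> simp
      have hper2 : PeriodicOn s r 5 2 := by
        intro i hi hi2
        obtain rfl | rfl | rfl : i = r ∨ i = r + 1 ∨ i = r + 2 := by omega
        · exact alt _ n0 n1
        · exact alt _ n1 n2
        · exact alt _ n2 n3
      exact h0.false_of_overlap hper2 (by norm_num) (le_refl r) (by omega) (by omega) (by omega)

/-- A sequence built from blocks contains no cube of period less than `k`. -/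
theorem no_cube {r p : ℕ} (hk : 5 ≤ k) (hodd : k % 2 = 1) (hr : r < k) (hp : 1 ≤ p)
    (hpk : p < k) (hper : PeriodicOn s r (3 * p) p)
    (h0 : IsBlock k s 0) (h1 : k < r + 3 * p → IsBlock k s k)
    (h2 : 2 * k < r + 3 * p → IsBlock k s (2 * k)) : False := by
  rcases Nat.mod_two_eq_zero_or_one p with hpar | hpar
  · exact no_even_cube hk hodd hr hp hpk hpar hper h0 h1 h2
  · exact no_odd_cube hk hodd hr hp hpk hpar hper h0 h1 h2

end IsBlock

theorem PeriodicOn.reverse {s : ℕ → Bool} {a n p N : ℕ} (h : PeriodicOn s a n p)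
    (hN : a + n ≤ N) : PeriodicOn (fun i => s (N - 1 - i)) (N - a - n) n p := by
  intro i hi hip
  have := h (N - 1 - (i + p)) (by omega) (by omega)
  rw [show N - 1 - (i + p) + p = N - 1 - i by omega] at this
  exact this.symm

/-- The sequence `s` is on its first `W * k` positions the image of the sequence `w` under the
complementary morphism sending `false` to the first `k` letters of `V`. -/
def IsImage (k W : ℕ) (V w s : ℕ → Bool) : Prop :=
  ∀ b < W, ∀ j < k, s (b * k + j) = (V j ^^ w b)

namespace IsImage

variable {k W : ℕ} {V w s : ℕ → Bool}

theorem reverse (h : IsImage k W V w s) :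
    IsImage k W (fun j => V (k - 1 - j)) (fun b => w (W - 1 - b))
      (fun i => s (W * k - 1 - i)) := by
  intro b hb j hj
  have := h (W - 1 - b) (by omega) (k - 1 - j) (by omega)
  simp only [← this]
  congr 1
  obtain ⟨c, rfl⟩ : ∃ c, W = b + 1 + c := ⟨W - b - 1, by omega⟩
  rw [show b + 1 + c - 1 - b = c by omega]
  have : (b + 1 + c) * k = b * k + k + c * k := by ring
  omega

theorem shift (h : IsImage k W V w s) (B : ℕ) :
    IsImage k (W - B) V (fun b => w (B + b)) (fun i => s (B * k + i)) := by
  intro b hb j hj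
  have := h (B + b) (by omega) j hj
  simp only [← this, add_mul, add_assoc]

theorem isBlock (h : IsImage k W V w s) (hk : 5 ≤ k) (hV : IsBlock k V 0) {b : ℕ} (hb : b < W) :
    IsBlock k s (b * k) := by
  have h := h b hb
  refine ⟨fun j hj hjk => ?_, ?_, ?_, ?_, fun a q hq haq => ?_⟩
  · have := hV.parity j hj hjk
    rw [add_assoc, h _ (by omega), h _ (by omega)]
    simpa using this
  · have := hV.head
    rw [h _ (by omega), h _ (by omega)]
    simpa using this
  · have := hV.tail
    rw [h _ (by omega), h _ (by omega)]
    simpa using this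
  · have := hV.last
    rw [h _ (by omega), h _ (by omega)]
    simpa using this
  · obtain ⟨i, hi, hne⟩ := hV.overlap_free a q hq haq
    refine ⟨i, hi, ?_⟩
    rw [show b * k + a + i + q = b * k + (a + i + q) by ring, add_assoc (b * k),
      h _ (by omega), h _ (by omega)]
    simpa using hne

theorem no_short_cube (h : IsImage k W V w s) (hk : 5 ≤ k) (hodd : k % 2 = 1)
    (hV : IsBlock k V 0) {a p : ℕ} (hp : 1 ≤ p) (hpk : p < k) (hW : a + 3 * p ≤ W * k)
    (hper : PeriodicOn s a (3 * p) p) : False := by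
  have hdiv := Nat.div_add_mod' a k
  have hmod := Nat.mod_lt a (show 0 < k by omega)
  set B := a / k
  set r := a % k
  have hblock : ∀ t, t * k < r + 3 * p → IsBlock k (fun i => s (B * k + i)) (t * k) := by
    intro t ht
    apply (h.shift B).isBlock hk hV
    have : (B + t) * k < W * k := by rw [add_mul]; omega
    have := lt_of_mul_lt_mul_right this (by omega)
    omega
  refine IsBlock.no_cube (s := fun i => s (B * k + i)) hk hodd hmod hp hpk ?_
    (by simpa using hblock 0 (by omega)) (by simpa using hblock 1) (hblock 2)
  intro i hi hip
  have := hper (B * k + i) (by omega) (by omega)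
  rwa [add_assoc] at this

theorem dvd_of_periodicOn (h : IsImage k W V w s) (hk : 5 ≤ k) (hodd : k % 2 = 1)
    (hV : IsBlock k V 0) {a n p : ℕ} (hn : 2 * k + p ≤ n) (hW : a + n ≤ W * k)
    (hper : PeriodicOn s a n p) : k ∣ p := by
  have hdiv := Nat.div_add_mod' (a + k - 1) k
  have hmod := Nat.mod_lt (a + k - 1) (show 0 < k by omega)
  set b := (a + k - 1) / k
  have hdiv' := Nat.div_add_mod' (b * k + p) k
  have hmod' := Nat.mod_lt (b * k + p) (show 0 < k by omega)
  set d := (b * k + p) % k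
  set b' := (b * k + p) / k
  have hlt : ∀ c, c * k < W * k → c < W := fun c hc => lt_of_mul_lt_mul_right hc (by omega)
  have hsucc : (b' + 1) * k = b' * k + k := by ring
  have hd0 : d = 0 := by
    refine IsBlock.occurrence_eq_zero hk hodd (h.isBlock hk hV (hlt b (by omega)))
      (h.isBlock hk hV (hlt b' (by omega))) (fun hd0 => ?_) hmod' ?_
    · rw [← hsucc]
      exact h.isBlock hk hV (hlt _ (by omega))
    · intro j hj
      rw [hdiv', hper _ (by omega) (by omega)]
      congr 1
      ring
  exact (Nat.dvd_add_right (Dvd.intro_left b rfl)).1 (Nat.dvd_of_mod_eq_zero hd0)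

theorem exists_preimage_power (h : IsImage k W V w s) (hk : 5 ≤ k) (hodd : k % 2 = 1)
    (hV : IsBlock k V 0) {a n p : ℕ} (hp : 1 ≤ p) (hn : 3 * k * p < k * n + p)
    (hW : a + n ≤ W * k) (hper : PeriodicOn s a n p) :
    ∃ b m q, 1 ≤ q ∧ b + m ≤ W ∧ PeriodicOn w b m q ∧ 3 * k * q < k * m + q := by
  rcases lt_or_ge p k with hpk | hpk
  · have h3 : 3 * p ≤ n := by
      by_contra! hlt
      have : k * (n + 1) ≤ k * (3 * p) := Nat.mul_le_mul_left k hlt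
      nlinarith
    exact (h.no_short_cube hk hodd hV (a := a) hp hpk (by omega)
      fun i hi hip => hper i hi (by omega)).elim
  · have hn2 : 2 * k + p ≤ n := by
      by_contra! hlt
      have : k * (n + 1) ≤ k * (2 * k + p) := Nat.mul_le_mul_left k hlt
      obtain ⟨e, rfl⟩ : ∃ e, p = k + e := ⟨p - k, by omega⟩
      nlinarith
    obtain ⟨q, rfl⟩ := h.dvd_of_periodicOn hk hodd hV hn2 hW hper
    have hdiv := Nat.div_add_mod' a k
    have hmod := Nat.mod_lt a (show 0 < k by omega)
    have hdiv' := Nat.div_add_mod' (a + n - 1) k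
    have hmod' := Nat.mod_lt (a + n - 1) (show 0 < k by omega)
    set b := a / k
    set e := (a + n - 1) / k
    have hbe : b ≤ e := Nat.div_le_div_right (by omega)
    have heW : e < W := lt_of_mul_lt_mul_right (show e * k < W * k by omega) (by omega)
    refine ⟨b, e + 1 - b, q, Nat.pos_of_ne_zero (by rintro rfl; simp at hp), by omega, ?_, ?_⟩
    · intro j hj hjq
      have hjk : b * k ≤ j * k := Nat.mul_le_mul_right k hj
      have hjq : (j + q) * k ≤ e * k := Nat.mul_le_mul_right k (by omega)
      have hjq' : (j + q) * k = j * k + k * q := by ring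
      obtain ⟨x, hx, hax, hxe⟩ : ∃ x < k, a ≤ j * k + x ∧ j * k + x + k * q < a + n := by
        by_cases haj : a ≤ j * k
        · exact ⟨0, by omega, by omega, by omega⟩
        · exact ⟨a - j * k, by omega, by omega, by omega⟩
      have := hper _ hax hxe
      rw [show j * k + x + k * q = (j + q) * k + x by ring, h j (by omega) x hx,
        h (j + q) (by omega) x hx] at this
      simpa using this
    · have hm : n ≤ k * (e + 1 - b) := by
        obtain ⟨c, hc⟩ : ∃ c, e = b + c := ⟨e - b, by omega⟩
        rw [hc, show b + c + 1 - b = c + 1 by omega]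
        rw [hc] at hdiv'
        have : (b + c) * k = b * k + k * c := by ring
        have : k * (c + 1) = k * c + k := by ring
        omega
      have : k * (3 * k * q) < k * (n + q) := by nlinarith
      have := lt_of_mul_lt_mul_left this (by omega)
      omega

end IsImage

theorem div_le_ce {w : List Bool} {a n p : ℕ} (hp : 1 ≤ p) (hpn : p ≤ n) (hw : a + n ≤ w.length)
    (hper : PeriodicOn (fun i => w.getD i false) a n p) : (n : ℝ) / p ≤ ce w := by
  have hlen : ((w.drop a).take n).length = n := by simp; omega
  have hne : (w.drop a).take n ≠ [] := List.ne_nil_of_length_pos (by omega)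
  have hx : HasPeriodW ((w.drop a).take n) p := by
    refine ⟨hp, by omega, fun i hi => ?_⟩
    have := hper (a + i) (by omega) (by omega)
    simp only [List.getD_eq_getElem?_getD, List.getElem?_take, List.getElem?_drop] at this ⊢
    rw [if_pos (by omega), if_pos (by omega), this, add_assoc]
  have h1 : (1 : ℝ) ≤ per ((w.drop a).take n) := by exact_mod_cast (hasPeriodW_per hne).1
  have h2 : (per ((w.drop a).take n) : ℝ) ≤ p := by exact_mod_cast Nat.sInf_le hx
  calc (n : ℝ) / p ≤ wexp ((w.drop a).take n) := by
        unfold wexp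
        rw [hlen]
        gcongr
    _ ≤ ce w := le_csSup (bddAbove_wexp w) ⟨_, hne,
        (List.take_prefix _ _).isInfix.trans (List.drop_suffix _ _).isInfix, rfl⟩

theorem ce_le_s19 {w : List Bool} {α : ℝ} (hα : 0 ≤ α)
    (h : ∀ a n p, 1 ≤ p → a + n ≤ w.length →
      PeriodicOn (fun i => w.getD i false) a n p → (n : ℝ) / p ≤ α) : ce w ≤ α := by
  refine Real.sSup_le ?_ hα
  rintro _ ⟨x, hx, ⟨l, r, rfl⟩, rfl⟩
  obtain ⟨h1, -, h3⟩ := hasPeriodW_per hx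
  refine h l.length x.length (per x) h1 (by simp) ?_
  have hget : ∀ i, l.length ≤ i → i < l.length + x.length →
      (l ++ x ++ r).getD i false = x.getD (i - l.length) false := by
    intro i hi hi2
    rw [List.getD_append _ _ _ _ (by simpa using hi2), List.getD_append_right _ _ _ _ hi]
  intro i hi hip
  simp only
  rw [hget i hi (by omega), hget _ (by omega) hip, h3 _ (by omega)]
  congr 1
  omega

theorem length_applyMorph_wcompl (v w : List Bool) :
    (applyMorph v (wcompl v) w).length = w.length * v.length := by
  induction w with
  | nil => simp [applyMorph]
  | cons c w ih =>
    have : applyMorph v (wcompl v) (c :: w) =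
      (bif c then wcompl v else v) ++ applyMorph v (wcompl v) w := rfl
    rw [this, List.length_append, ih, List.length_cons]
    cases c <;> simp [wcompl] <;> ring

theorem isImage_applyMorph (v w : List Bool) :
    IsImage v.length w.length (fun j => v.getD j false) (fun b => w.getD b false)
      (fun i => (applyMorph v (wcompl v) w).getD i false) := by
  induction w with
  | nil => intro b hb; simp at hb
  | cons c w ih =>
    intro b hb j hj
    have : applyMorph v (wcompl v) (c :: w) =
      (bif c then wcompl v else v) ++ applyMorph v (wcompl v) w := rfl
    have hlen : (bif c then wcompl v else v).length = v.length := by cases c <;> simp [wcompl]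
    simp only [this]
    cases b with
    | zero =>
      rw [List.getD_append _ _ _ _ (by omega)]
      cases c <;> simp [wcompl, hj]
    | succ b =>
      rw [List.getD_append_right _ _ _ _ (by rw [hlen]; nlinarith), hlen,
        show (b + 1) * v.length + j - v.length = b * v.length + j by
          rw [add_mul]; omega]
      exact ih b (by simpa using hb) j hj

theorem getD_of_isPrefix {x v : List Bool} (h : x <+: v) {i : ℕ} (hi : i < x.length) :
    v.getD i false = x.getD i false := by
  obtain ⟨r, rfl⟩ := h
  exact List.getD_append _ _ _ _ hi

theorem getD_of_isSuffix {x v : List Bool} (h : x <:+ v) {i : ℕ} :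
    v.getD (v.length - x.length + i) false = x.getD i false := by
  obtain ⟨r, rfl⟩ := h
  rw [List.getD_append_right _ _ _ _ (by simp)]
  congr 1
  simp

theorem IsTMFactor.exists_getD {v : List Bool} (h : IsTMFactor v) :
    ∃ ℓ, ∀ j < v.length, v.getD j false = tm (ℓ + j) := by
  obtain ⟨ℓ, hℓ⟩ := h
  refine ⟨ℓ, fun j hj => ?_⟩
  rw [hℓ]
  simp [tmFactor, hj]

theorem isBlock_of_tm {k ℓ : ℕ} {V : ℕ → Bool} (hV : ∀ j < k, V j = tm (ℓ + j)) (hk : 4 ≤ k)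
    (h12 : V 1 = V 2) (htail : V (k - 4) = V (k - 3)) (hlast : V (k - 2) ≠ V (k - 1)) :
    5 ≤ k ∧ k % 2 = 1 ∧ IsBlock k V 0 := by
  have odd_of : ∀ i, i + 1 < k → V i = V (i + 1) → (ℓ + i) % 2 = 1 := by
    intro i hi he
    rw [hV i (by omega), hV (i + 1) hi] at he
    by_contra hcon
    exact tm_ne_succ_of_even (by omega) he
  have o1 := odd_of 1 (by omega) h12
  have o2 := odd_of (k - 4) (by omega) (by rwa [show k - 4 + 1 = k - 3 by omega])
  refine ⟨by omega, by omega, fun j hj hjk he => ?_, h12, by simpa using htail,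
    by simpa using hlast, fun a q hq haq => ?_⟩
  · have := odd_of j hjk (by simpa using he)
    omega
  · obtain ⟨i, hi, hne⟩ := tm_overlap_free q hq (ℓ + a)
    refine ⟨i, hi, ?_⟩
    rw [hV _ (by omega), hV _ (by omega)]
    convert hne using 2 <;> ring_nf

theorem isBlock_of_reverse_tm {k ℓ : ℕ} {V : ℕ → Bool} (hV : ∀ j < k, V j = tm (ℓ + j))
    (hk : 4 ≤ k) (h01 : V 0 ≠ V 1) (h23 : V 2 = V 3) (htail : V (k - 3) = V (k - 2)) :
    5 ≤ k ∧ k % 2 = 1 ∧ IsBlock k (fun j => V (k - 1 - j)) 0 := by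
  have odd_of : ∀ i, i + 1 < k → V i = V (i + 1) → (ℓ + i) % 2 = 1 := by
    intro i hi he
    rw [hV i (by omega), hV (i + 1) hi] at he
    by_contra hcon
    exact tm_ne_succ_of_even (by omega) he
  have o1 := odd_of 2 (by omega) h23
  have o2 := odd_of (k - 3) (by omega) (by rwa [show k - 3 + 1 = k - 2 by omega])
  refine ⟨by omega, by omega, fun j hj hjk he => ?_, ?_, ?_, ?_, fun a q hq haq => ?_⟩
  · have := odd_of (k - 1 - (j + 1)) (by omega) (by
      rw [show k - 1 - (j + 1) + 1 = k - 1 - j by omega]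
      simpa using he.symm)
    omega
  · simp only [show k - 1 - (0 + 1) = k - 2 by omega, show k - 1 - (0 + 2) = k - 3 by omega]
    exact htail.symm
  · simp only [show k - 1 - (0 + (k - 4)) = 3 by omega, show k - 1 - (0 + (k - 3)) = 2 by omega]
    exact h23.symm
  · simp only [show k - 1 - (0 + (k - 2)) = 1 by omega, show k - 1 - (0 + (k - 1)) = 0 by omega]
    exact h01.symm
  · obtain ⟨i, hi, hne⟩ := tm_overlap_free q hq (ℓ + (k - 1 - (a + 2 * q)))
    refine ⟨q - i, by omega, ?_⟩
    rw [hV _ (by omega), hV _ (by omega)]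
    convert hne.symm using 2 <;> omega

/-- if `v` is a factor of the Thue–Morse word of length `k`
having (a) prefix `0110` or `1001` and suffix `0010` or `1101`, or
(b) prefix `0100` or `1011` and suffix `0110` or `1001`, then the clipped
Thue–Morse morphism `f_v` is `(3 - 1/k)⁺`-free. -/
theorem stmt19 (v : List Bool) (k : ℕ) (hk : v.length = k) (hv : IsTMFactor v)
    (hcond :
      ((([false, true, true, false] <+: v) ∨ ([true, false, false, true] <+: v)) ∧
       (([false, false, true, false] <:+ v) ∨ ([true, true, false, true] <:+ v))) ∨
      ((([false, true, false, false] <+: v) ∨ ([true, false, true, true] <+: v)) ∧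
       (([false, true, true, false] <:+ v) ∨ ([true, false, false, true] <:+ v)))) :
    ∀ w : List Bool, ce w ≤ 3 - 1 / (k : ℝ) →
      ce (applyMorph v (wcompl v) w) ≤ 3 - 1 / (k : ℝ) := by
  subst hk
  intro w hw
  have himg := isImage_applyMorph v w
  have hlen := length_applyMorph_wcompl v w
  obtain ⟨ℓ, hℓ⟩ := hv.exists_getD
  have key : 5 ≤ v.length ∧ ∀ a n p, 1 ≤ p → 3 * v.length * p < v.length * n + p →
      a + n ≤ w.length * v.length →
      PeriodicOn (fun i => (applyMorph v (wcompl v) w).getD i false) a n p →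
      ∃ b m q, 1 ≤ q ∧ b + m ≤ w.length ∧ PeriodicOn (fun i => w.getD i false) b m q ∧
        3 * v.length * q < v.length * m + q := by
    have four_le : ∀ x : List Bool, x.length = 4 → x <+: v → 4 ≤ v.length :=
      fun x hx h => hx ▸ h.length_le
    have pre : ∀ x : List Bool, x <+: v → ∀ i < x.length, v.getD i false = x.getD i false :=
      fun x h i hi => getD_of_isPrefix h hi
    have suf : ∀ x : List Bool, x <:+ v → x.length = 4 → 4 ≤ v.length → ∀ i < 4,
        v.getD (v.length - (4 - i)) false = x.getD i false := by
      intro x h hx hk i hi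
      rw [← getD_of_isSuffix h, hx]
      congr 1
      omega
    rcases hcond with ⟨h1, h2⟩ | ⟨h1, h2⟩
    · have hk : 4 ≤ v.length := h1.elim (four_le _ rfl) (four_le _ rfl)
      obtain ⟨hk5, hodd, hV⟩ := isBlock_of_tm (V := fun j => v.getD j false) hℓ hk
        (by rcases h1 with h | h <;> simp only [pre _ h 1 (by simp), pre _ h 2 (by simp)] <;> rfl)
        (by rcases h2 with h | h <;>
          exact (suf _ h rfl hk 0 (by simp)).trans (suf _ h rfl hk 1 (by simp)).symm)
        (by rcases h2 with h | h <;>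
          exact fun he => absurd ((suf _ h rfl hk 2 (by simp)).symm.trans
            (he.trans (suf _ h rfl hk 3 (by simp)))) (by simp))
      exact ⟨hk5, fun a n p hp hn hW hper =>
        himg.exists_preimage_power hk5 hodd hV hp hn hW hper⟩
    · have hk : 4 ≤ v.length := h1.elim (four_le _ rfl) (four_le _ rfl)
      obtain ⟨hk5, hodd, hV⟩ := isBlock_of_reverse_tm (V := fun j => v.getD j false) hℓ hk
        (by rcases h1 with h | h <;> simp only [pre _ h 0 (by simp), pre _ h 1 (by simp)] <;> simp)
        (by rcases h1 with h | h <;> simp only [pre _ h 2 (by simp), pre _ h 3 (by simp)] <;> rfl)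
        (by rcases h2 with h | h <;>
          exact (suf _ h rfl hk 1 (by simp)).trans (suf _ h rfl hk 2 (by simp)).symm)
      refine ⟨hk5, fun a n p hp hn hW hper => ?_⟩
      obtain ⟨b, m, q, hq, hbm, hper', hlt⟩ :=
        himg.reverse.exists_preimage_power hk5 hodd hV hp hn (by omega) (hper.reverse hW)
      refine ⟨w.length - b - m, m, q, hq, by omega, ?_, hlt⟩
      intro i hi hip
      have := hper'.reverse hbm i hi hip
      simp only at this
      rwa [show w.length - 1 - (w.length - 1 - i) = i by omega,
        show w.length - 1 - (w.length - 1 - (i + q)) = i + q by omega] at this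
  obtain ⟨hk5, key⟩ := key
  have hk0 : (5 : ℝ) ≤ v.length := by exact_mod_cast hk5
  have hkinv : 1 / (v.length : ℝ) ≤ 1 := by rw [div_le_one (by linarith)]; linarith
  have ratio : ∀ n p : ℕ, 1 ≤ p → ((n : ℝ) / p ≤ 3 - 1 / (v.length : ℝ) ↔
      v.length * n + p ≤ 3 * v.length * p) := by
    intro n p hp
    have hp0 : (0 : ℝ) < p := by exact_mod_cast hp
    rw [div_le_iff₀ hp0, ← @Nat.cast_le ℝ,
      ← mul_le_mul_iff_right₀ (show (0 : ℝ) < v.length by linarith)]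
    have : (v.length : ℝ) * ((3 - 1 / (v.length : ℝ)) * p) = 3 * v.length * p - p := by
      field_simp
    rw [this]
    push_cast
    exact le_sub_iff_add_le
  refine ce_le_s19 (by linarith) fun a n p hp hW hper => ?_
  rw [ratio n p hp]
  by_contra! hn
  obtain ⟨b, m, q, hq, hbm, hper', hlt⟩ := key a n p hp hn (by omega) hper
  have hqm : q ≤ m := by
    by_contra! h
    have : v.length * m ≤ v.length * q := Nat.mul_le_mul_left _ h.le
    nlinarith
  have := (ratio m q hq).1 ((div_le_ce hq hqm hbm hper').trans hw)
  omega
end
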